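/- Let 𝒲, 𝒳, 𝒴, 𝓑 be finite sets with |𝓑| ≥ 2, let P_W be a distribution on 𝒲, and let π_{XY} be a distribution on 𝒳×𝒴 such that there exists y ∈ 𝒴 with π_{Y|X}(y|x) > 0 for every x with π_X(x) > 0. For each n, let Γ^{(n)}(π_{XY}, P_W) be the infimum of D(P_{Y^n|X^n} ‖ π_{Y|X}^n | π_X^n) over all sequential codes of blocklength n, and set Γ(π_{XY}, P_W) = lim_{n→∞} (1/n) Γ^{(n)}(π_{XY}, P_W). Then Γ(π_{XY}, P_W) = Δ(π_{XY}, P_W), where Δ(π_{XY}, P_W) is the minimum, over finite auxiliary alphabets 𝒰, 𝒱 with |𝒱| ≤ 2 and |𝒰| ≤ 2|𝒳||𝒴| and distributions P_{UV}, P_{B|XUV}, P_{Y|BUV} satisfying H(U|V) ≤ H(BU|XYV) + H(W), of D(P_{Y|XV} ‖ π_{Y|X} | π_X P_V), with entropies evaluated under the joint distribution π_X P_{UV} P_{B|XUV} P_{Y|BUV}. -/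

import Mathlib

open scoped BigOperators ENNReal
open Classical

noncomputable section

/-- `p` is a probability mass function on the finite type `α`. -/
def IsDist {α : Type} [Fintype α] (p : α → ℝ) : Prop :=
  (∀ a, 0 ≤ p a) ∧ (∑ a, p a) = 1

/-- `k` is a conditional probability kernel. -/
def IsKernel {α β : Type} [Fintype β] (k : α → β → ℝ) : Prop :=
  ∀ a, (∀ b, 0 ≤ k a b) ∧ (∑ b, k a b) = 1

/-- Marginal (pushforward) of `p` along the map `f`. -/
def marg {α β : Type} [Fintype α] (f : α → β) (p : α → ℝ) : β → ℝ :=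
  fun b => ∑ a, if f a = b then p a else 0

/-- Shannon entropy (natural log). -/
def ent {α : Type} [Fintype α] (p : α → ℝ) : ℝ :=
  ∑ a, Real.negMulLog (p a)

/-- Conditional entropy `H(f(A) | g(A))` for `A ∼ p`. -/
def condEnt {α β γ : Type} [Fintype α] [Fintype β] [Fintype γ]
    (f : α → β) (g : α → γ) (p : α → ℝ) : ℝ :=
  ent (marg (fun a => (f a, g a)) p) - ent (marg g p)

/-- Kullback–Leibler divergence `D(p‖q)` with value `⊤` if `p` is not absolutely
continuous with respect to `q`. -/
def KL {α : Type} [Fintype α] (p q : α → ℝ) : ℝ≥0∞ :=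
  if ∀ a, q a = 0 → p a = 0 then ENNReal.ofReal (∑ a, p a * Real.log (p a / q a)) else ⊤

/-- The joint distribution `π_X P_{UV} P_{B|XUV} P_{Y|BUV}` on `X × U × V × B × Y`. -/
def seqJoint {X Y B U V : Type} (πX : X → ℝ) (PUV : U × V → ℝ)
    (PB : X × U × V → B → ℝ) (PY : B × U × V → Y → ℝ) : X × U × V × B × Y → ℝ :=
  fun q => πX q.1 * PUV (q.2.1, q.2.2.1) * PB (q.1, q.2.1, q.2.2.1) q.2.2.2.1 *
    PY (q.2.2.2.1, q.2.1, q.2.2.1) q.2.2.2.2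

/-- The set of values `D(P_{Y|XV} ‖ π_{Y|X} | π_X P_V)` over all feasible tuples
`(𝒰, 𝒱, P_{UV}, P_{B|XUV}, P_{Y|BUV})` with `H(U|V) ≤ H(BU|XYV) + t`. -/
def psiSet (X Y B : Type) [Fintype X] [Fintype Y] [Fintype B] (π : X × Y → ℝ) (t : ℝ) :
    Set ℝ≥0∞ :=
  { d | ∃ (m l : ℕ) (PUV : Fin m × Fin l → ℝ)
      (PB : X × Fin m × Fin l → B → ℝ) (PY : B × Fin m × Fin l → Y → ℝ),
      IsDist PUV ∧ IsKernel PB ∧ IsKernel PY ∧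
      condEnt (fun q : X × Fin m × Fin l × B × Y => q.2.1)
          (fun q => q.2.2.1) (seqJoint (marg Prod.fst π) PUV PB PY) ≤
        condEnt (fun q : X × Fin m × Fin l × B × Y => (q.2.2.2.1, q.2.1))
          (fun q => (q.1, q.2.2.2.2, q.2.2.1)) (seqJoint (marg Prod.fst π) PUV PB PY) + t ∧
      d = KL (marg (fun q : X × Fin m × Fin l × B × Y => (q.1, q.2.2.1, q.2.2.2.2))
              (seqJoint (marg Prod.fst π) PUV PB PY))
            (fun r : X × Fin l × Y => marg Prod.snd PUV r.2.1 * π (r.1, r.2.2)) }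

/-- `Ψ(t)`, with the convention `Ψ(t) = ⊤` when there is no feasible tuple. -/
def Psi (X Y B : Type) [Fintype X] [Fintype Y] [Fintype B] (π : X × Y → ℝ) (t : ℝ) : ℝ≥0∞ :=
  sInf (psiSet X Y B π t)

/-- Same as `psiSet`, but with the auxiliary alphabets restricted to
`|𝒱| ≤ 2` and `|𝒰| ≤ 2·|𝒳|·|𝒴|`. -/
def psiSetBdd (X Y B : Type) [Fintype X] [Fintype Y] [Fintype B] (π : X × Y → ℝ) (t : ℝ) :
    Set ℝ≥0∞ :=
  { d | ∃ (m l : ℕ), m ≤ 2 * Fintype.card X * Fintype.card Y ∧ l ≤ 2 ∧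
      ∃ (PUV : Fin m × Fin l → ℝ)
        (PB : X × Fin m × Fin l → B → ℝ) (PY : B × Fin m × Fin l → Y → ℝ),
      IsDist PUV ∧ IsKernel PB ∧ IsKernel PY ∧
      condEnt (fun q : X × Fin m × Fin l × B × Y => q.2.1)
          (fun q => q.2.2.1) (seqJoint (marg Prod.fst π) PUV PB PY) ≤
        condEnt (fun q : X × Fin m × Fin l × B × Y => (q.2.2.2.1, q.2.1))
          (fun q => (q.1, q.2.2.2.2, q.2.2.1)) (seqJoint (marg Prod.fst π) PUV PB PY) + t ∧
      d = KL (marg (fun q : X × Fin m × Fin l × B × Y => (q.1, q.2.2.1, q.2.2.2.2))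
              (seqJoint (marg Prod.fst π) PUV PB PY))
            (fun r : X × Fin l × Y => marg Prod.snd PUV r.2.1 * π (r.1, r.2.2)) }

/-- A sequential code of blocklength `n`: at epoch `k`, the encoder produces
`B_k` from `(W^k, X^k, B^{k-1})` and the decoder produces `Y_k` from
`(W^k, B^k, Y^{k-1})`.  Kernels are given on full histories together with
causality (prefix-dependence) conditions. -/
structure SeqCode (W X Y B : Type) [Fintype W] [Fintype X] [Fintype Y] [Fintype B]
    (n : ℕ) where
  enc : Fin n → (Fin n → W) → (Fin n → X) → (Fin n → B) → B → ℝ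
  dec : Fin n → (Fin n → W) → (Fin n → B) → (Fin n → Y) → Y → ℝ
  enc_dist : ∀ k w x b, IsDist (enc k w x b)
  dec_dist : ∀ k w b y, IsDist (dec k w b y)
  enc_causal : ∀ k w w' x x' b b',
    (∀ i, i ≤ k → w i = w' i) → (∀ i, i ≤ k → x i = x' i) → (∀ i, i < k → b i = b' i) →
    enc k w x b = enc k w' x' b'
  dec_causal : ∀ k w w' b b' y y',
    (∀ i, i ≤ k → w i = w' i) → (∀ i, i ≤ k → b i = b' i) → (∀ i, i < k → y i = y' i) →
    dec k w b y = dec k w' b' y'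

/-- The channel `P_{Y^n|X^n}` synthesized by a sequential code, with common
randomness `W_i` i.i.d. `∼ P_W`. -/
def SeqCode.channel {W X Y B : Type} [Fintype W] [Fintype X] [Fintype Y] [Fintype B]
    {n : ℕ} (C : SeqCode W X Y B n) (PW : W → ℝ) (x : Fin n → X) (y : Fin n → Y) : ℝ :=
  ∑ w : Fin n → W, ∑ b : Fin n → B,
    (∏ k, PW (w k)) * (∏ k, C.enc k w x b (b k)) * (∏ k, C.dec k w b y (y k))

/-- `Γ^{(n)}(π_{XY}, P_W)`: the least value of
`D(P_{Y^n|X^n} ‖ π_{Y|X}^n | π_X^n)` over sequential codes of blocklength `n`. -/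
def GammaN (W X Y B : Type) [Fintype W] [Fintype X] [Fintype Y] [Fintype B]
    (PW : W → ℝ) (π : X × Y → ℝ) (n : ℕ) : ℝ≥0∞ :=
  sInf { d | ∃ C : SeqCode W X Y B n,
    d = KL
      (fun p : (Fin n → X) × (Fin n → Y) =>
        (∏ i, marg Prod.fst π (p.1 i)) * C.channel PW p.1 p.2)
      (fun p : (Fin n → X) × (Fin n → Y) => ∏ i, π (p.1 i, p.2 i)) }

set_option linter.unusedSectionVars false

/-! ### Expectations under product weights -/

section ProductWeights

variable {ι α : Type*} [Fintype ι] [Fintype α] [DecidableEq ι]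

theorem sum_pi_prod_mul (p ψ : ι → α → ℝ) :
    ∑ g : ι → α, (∏ i, p i (g i)) * ∏ i, ψ i (g i) = ∏ i, ∑ a, p i a * ψ i a := by
  simp only [← Finset.prod_mul_distrib]
  exact (Fintype.prod_sum fun i a => p i a * ψ i a).symm

theorem sum_pi_prod_eq_one {p : ι → α → ℝ} (hp : ∀ i, ∑ a, p i a = 1) :
    ∑ g : ι → α, ∏ i, p i (g i) = 1 := by
  rw [← Fintype.prod_sum]
  simp [hp]

theorem sum_pi_prod_mul_apply {p : ι → α → ℝ} (hp : ∀ i, ∑ a, p i a = 1) (i : ι) (φ : α → ℝ) :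
    ∑ g : ι → α, (∏ k, p k (g k)) * φ (g i) = ∑ a, p i a * φ a := by
  have h := sum_pi_prod_mul p (fun k a => if k = i then φ a else 1)
  simp only [Finset.prod_ite_eq', Finset.mem_univ, if_true] at h
  rw [h, Finset.prod_eq_single i]
  · simp
  · intro k _ hk
    simp [hk, hp]
  · simp

/-- The variance of a sum of independent centered variables is the sum of the variances. -/
theorem sum_pi_prod_mul_sq {p φ : ι → α → ℝ} (hp : ∀ i, ∑ a, p i a = 1)
    (hφ : ∀ i, ∑ a, p i a * φ i a = 0) :
    ∑ g : ι → α, (∏ i, p i (g i)) * (∑ i, φ i (g i)) ^ 2 = ∑ i, ∑ a, p i a * φ i a ^ 2 := by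
  have key : ∀ i j, ∑ g : ι → α, (∏ k, p k (g k)) * (φ i (g i) * φ j (g j)) =
      if i = j then ∑ a, p i a * φ i a ^ 2 else 0 := by
    intro i j
    split_ifs with hij
    · subst hij
      simpa [sq] using sum_pi_prod_mul_apply hp i (fun a => φ i a * φ i a)
    · have h := sum_pi_prod_mul p
        (fun k a => (if k = i then φ k a else 1) * (if k = j then φ k a else 1))
      simp only [Finset.prod_mul_distrib, Finset.prod_ite_eq', Finset.mem_univ, if_true] at h
      rw [h]
      exact Finset.prod_eq_zero (Finset.mem_univ i) (by simp [hij, hφ])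
  simp only [sq (∑ i, φ i _), Finset.sum_mul_sum]
  simp only [Finset.mul_sum]
  rw [Finset.sum_comm]
  refine Finset.sum_congr rfl fun i _ => ?_
  rw [Finset.sum_comm]
  simp [key]

/-- Chebyshev's inequality for sums of independent variables. -/
theorem sum_pi_prod_tail_le {p φ : ι → α → ℝ} (hp0 : ∀ i a, 0 ≤ p i a)
    (hp : ∀ i, ∑ a, p i a = 1) {v : ℝ} (hv : ∀ i, ∑ a, p i a * φ i a ^ 2 ≤ v)
    {κ : ℝ} (hκ : 0 < κ) :
    ∑ g : ι → α, (if (∑ i, ∑ a, p i a * φ i a) + κ ≤ ∑ i, φ i (g i)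
      then ∏ i, p i (g i) else 0) ≤ Fintype.card ι * v / κ ^ 2 := by
  set m : ι → ℝ := fun i => ∑ a, p i a * φ i a with hm
  have hc : ∀ i, ∑ a, p i a * (φ i a - m i) = 0 := by
    intro i
    simp only [mul_sub, Finset.sum_sub_distrib, ← Finset.sum_mul, hp]
    simp [hm]
  have hvar : ∀ i, ∑ a, p i a * (φ i a - m i) ^ 2 ≤ v := by
    intro i
    have : ∑ a, p i a * (φ i a - m i) ^ 2 = ∑ a, p i a * φ i a ^ 2 - m i ^ 2 := by
      have : ∀ a, p i a * (φ i a - m i) ^ 2 =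
          p i a * φ i a ^ 2 - 2 * m i * (p i a * φ i a) + m i ^ 2 * p i a := fun a => by ring
      simp only [this, Finset.sum_add_distrib, Finset.sum_sub_distrib, ← Finset.mul_sum, hp]
      simp only [hm]; ring
    rw [this]
    nlinarith [hv i, sq_nonneg (m i)]
  have h := sum_pi_prod_mul_sq hp hc
  rw [le_div_iff₀ (by positivity), Finset.sum_mul]
  calc _ ≤ ∑ g : ι → α, (∏ i, p i (g i)) * (∑ i, (φ i (g i) - m i)) ^ 2 := by
        refine Finset.sum_le_sum fun g _ => ?_
        have h0 : 0 ≤ ∏ i, p i (g i) := Finset.prod_nonneg fun i _ => hp0 _ _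
        split_ifs with hg
        · refine mul_le_mul_of_nonneg_left ?_ h0
          rw [Finset.sum_sub_distrib]
          exact pow_le_pow_left₀ hκ.le (by linarith) 2
        · rw [zero_mul]; positivity
    _ ≤ _ := by
        rw [h]
        calc _ ≤ ∑ i : ι, v := Finset.sum_le_sum fun i _ => hvar i
          _ = _ := by simp

/-- The first absolute moment is at most the root of the second moment. -/
theorem sum_mul_abs_le_of_sq {p z : α → ℝ} (hp0 : ∀ a, 0 ≤ p a) (hp : ∑ a, p a = 1)
    {c : ℝ} (hc : 0 ≤ c) (h : ∑ a, p a * z a ^ 2 ≤ c ^ 2) : ∑ a, p a * |z a| ≤ c := by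
  set m := ∑ a, p a * |z a| with hm
  have h1 : 0 ≤ ∑ a, p a * (|z a| - m) ^ 2 :=
    Finset.sum_nonneg fun a _ => mul_nonneg (hp0 a) (sq_nonneg _)
  have h2 : ∑ a, p a * (|z a| - m) ^ 2 = ∑ a, p a * z a ^ 2 - m ^ 2 := by
    have : ∀ a, p a * (|z a| - m) ^ 2 =
        p a * z a ^ 2 - 2 * m * (p a * |z a|) + m ^ 2 * p a := fun a => by
      rw [sub_sq, sq_abs]; ring
    simp only [this, Finset.sum_add_distrib, Finset.sum_sub_distrib, ← Finset.mul_sum, hp, ← hm]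
    ring
  exact le_of_sq_le_sq (by linarith) hc

end ProductWeights

theorem exists_le_of_sum_mul_le {α : Type*} [Fintype α] {p z : α → ℝ} (hp0 : ∀ a, 0 ≤ p a)
    (hp : ∑ a, p a = 1) {c : ℝ} (h : ∑ a, p a * z a ≤ c) : ∃ a, z a ≤ c := by
  by_contra! hc
  have h1 : ∑ a, p a * c = c := by rw [← Finset.sum_mul, hp, one_mul]
  have h2 : ∀ a, p a * c ≤ p a * z a := fun a => mul_le_mul_of_nonneg_left (hc a).le (hp0 a)
  have h3 : ∀ a, p a * c = p a * z a := by
    have : ∑ a, p a * c = ∑ a, p a * z a :=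
      le_antisymm (Finset.sum_le_sum fun a _ => h2 a) (by linarith)
    exact fun a => (Finset.sum_eq_sum_iff_of_le fun a _ => h2 a).1 this a (Finset.mem_univ a)
  have h4 : ∀ a, p a = 0 := fun a => by
    by_contra h0
    exact absurd (mul_left_cancel₀ h0 (h3 a)) (hc a).ne
  simp [h4] at hp

/-! ### Soft covering by a deterministic map -/

section SoftCovering

variable {A S T : Type*} [Fintype A] [Fintype S] [Fintype T] [DecidableEq A]

theorem sum_ite_eq_sub_mul_abs_le {q : T → ℝ} (hq0 : ∀ t, 0 ≤ q t) (hq : ∑ t, q t = 1)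
    {G : A → ℝ} (hG0 : ∀ a, 0 ≤ G a) (t : T) :
    ∑ f : A → T, (∏ a, q (f a)) * |∑ a, ((if f a = t then 1 else 0) - q t) * G a| ≤
      2 * q t * ∑ a, G a := by
  have h1 : ∀ f : A → T, (∏ a, q (f a)) * |∑ a, ((if f a = t then 1 else 0) - q t) * G a| ≤
      ∑ a, (∏ a, q (f a)) * (((if f a = t then 1 else 0) + q t) * G a) := by
    intro f
    rw [← Finset.mul_sum]
    refine mul_le_mul_of_nonneg_left ?_ (Finset.prod_nonneg fun a _ => hq0 _)
    refine (Finset.abs_sum_le_sum_abs _ _).trans (Finset.sum_le_sum fun a _ => ?_)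
    rw [abs_mul, abs_of_nonneg (hG0 a)]
    refine mul_le_mul_of_nonneg_right ?_ (hG0 a)
    have := hq0 t
    split_ifs <;> rw [abs_le] <;> constructor <;> linarith
  refine (Finset.sum_le_sum fun f _ => h1 f).trans ?_
  rw [Finset.sum_comm, Finset.mul_sum]
  refine Finset.sum_le_sum fun a _ => le_of_eq ?_
  rw [sum_pi_prod_mul_apply (p := fun _ : A => q) (fun _ => hq) a
    (fun u => ((if u = t then 1 else 0) + q t) * G a)]
  simp only [← mul_assoc, ← Finset.sum_mul, mul_add, Finset.sum_add_distrib, hq]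
  simp
  left; ring

theorem sum_ite_eq_sub_mul_abs_le_of_sq {q : T → ℝ} (hq0 : ∀ t, 0 ≤ q t) (hq : ∑ t, q t = 1)
    {G : A → ℝ} (t : T) {c : ℝ} (hc : 0 ≤ c) (h : q t * ∑ a, G a ^ 2 ≤ c ^ 2) :
    ∑ f : A → T, (∏ a, q (f a)) * |∑ a, ((if f a = t then 1 else 0) - q t) * G a| ≤ c := by
  refine sum_mul_abs_le_of_sq (fun f => Finset.prod_nonneg fun a _ => hq0 _)
    (sum_pi_prod_eq_one fun _ => hq) hc ?_
  rw [sum_pi_prod_mul_sq (p := fun _ : A => q)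
    (φ := fun a u => ((if u = t then 1 else 0) - q t) * G a) (fun _ => hq)]
  · refine le_trans ?_ h
    rw [Finset.mul_sum]
    refine Finset.sum_le_sum fun a _ => ?_
    have h1 : ∑ u, q u * (((if u = t then 1 else 0) - q t) * G a) ^ 2 =
        (q t - q t ^ 2) * G a ^ 2 := by
      have : ∀ u, q u * (((if u = t then 1 else 0) - q t) * G a) ^ 2 =
          ((if u = t then q u else 0) * (1 - 2 * q t) + q t ^ 2 * q u) * G a ^ 2 := by
        intro u; split_ifs <;> ring
      simp only [this, ← Finset.sum_mul, Finset.sum_add_distrib, ← Finset.mul_sum, hq]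
      simp
      left; ring
    rw [h1]
    exact mul_le_mul_of_nonneg_right (by nlinarith [sq_nonneg (q t)]) (sq_nonneg _)
  · intro a
    simp only [sub_mul, mul_sub, Finset.sum_sub_distrib, ← mul_assoc, ← Finset.sum_mul, hq]
    simp

/-- If the conditional law of `A` given `S` is spread out enough relative to `q`, then some map
`f` makes `f A` nearly `q`-distributed and nearly independent of `S`. -/
theorem exists_map_soft_covering {J : S → A → ℝ} (hJ0 : ∀ s a, 0 ≤ J s a)
    (hJ : ∑ s, ∑ a, J s a = 1) {q : T → ℝ} (hq0 : ∀ t, 0 ≤ q t) (hq : ∑ t, q t = 1) (α β : ℝ) :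
    ∃ f : A → T, ∑ s, ∑ t, |(∑ a, if f a = t then J s a else 0) - (∑ a, J s a) * q t| ≤
      Real.exp ((β - α) / 2) +
      2 * (∑ s, ∑ a, if J s a ≤ Real.exp (-α) * ∑ a', J s a' then 0 else J s a) +
      2 * ∑ t, if Real.exp (-β) ≤ q t then 0 else q t := by
  refine exists_le_of_sum_mul_le (p := fun f : A → T => ∏ a, q (f a))
    (fun f => Finset.prod_nonneg fun a _ => hq0 _) (sum_pi_prod_eq_one fun _ => hq) ?_
  set e := Real.exp ((β - α) / 2) with he
  set M : S → ℝ := fun s => ∑ a, J s a with hM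
  have hM0 : ∀ s, 0 ≤ M s := fun s => Finset.sum_nonneg fun a _ => hJ0 s a
  set G : S → A → ℝ := fun s a => if J s a ≤ Real.exp (-α) * M s then J s a else 0 with hG
  set G' : S → A → ℝ := fun s a => if J s a ≤ Real.exp (-α) * M s then 0 else J s a with hG'
  have hG0 : ∀ s a, 0 ≤ G s a := fun s a => by
    simp only [hG]; split_ifs; exacts [hJ0 s a, le_rfl]
  have hG'0 : ∀ s a, 0 ≤ G' s a := fun s a => by
    simp only [hG']; split_ifs; exacts [le_rfl, hJ0 s a]
  have hGG : ∀ s a, J s a = G s a + G' s a := fun s a => by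
    simp only [hG, hG']; split_ifs <;> simp
  have hGJ : ∀ s a, G s a ≤ J s a := fun s a => by linarith [hGG s a, hG'0 s a]
  have hGe : ∀ s a, G s a ≤ Real.exp (-α) * M s := fun s a => by
    simp only [hG]; split_ifs with h; exacts [h, mul_nonneg (Real.exp_pos _).le (hM0 s)]
  -- the contribution of a pair `(s, t)`
  have hst : ∀ s t, ∑ f : A → T, (∏ a, q (f a)) *
      |(∑ a, if f a = t then J s a else 0) - M s * q t| ≤
      M s * q t * e + 2 * (M s * (if Real.exp (-β) ≤ q t then 0 else q t)) +
        2 * (q t * ∑ a, G' s a) := by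
    intro s t
    have hsplit : ∀ f : A → T, (∑ a, if f a = t then J s a else 0) - M s * q t =
        ∑ a, ((if f a = t then 1 else 0) - q t) * G s a +
        ∑ a, ((if f a = t then 1 else 0) - q t) * G' s a := by
      intro f
      rw [← Finset.sum_add_distrib, hM, Finset.sum_mul, ← Finset.sum_sub_distrib]
      refine Finset.sum_congr rfl fun a _ => ?_
      rw [← mul_add, ← hGG]
      split_ifs <;> ring
    have h1 : ∑ f : A → T, (∏ a, q (f a)) *
        |∑ a, ((if f a = t then 1 else 0) - q t) * G s a| ≤
        M s * q t * e + 2 * (M s * (if Real.exp (-β) ≤ q t then 0 else q t)) := by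
      by_cases hb : Real.exp (-β) ≤ q t
      · rw [if_pos hb]
        refine (sum_ite_eq_sub_mul_abs_le_of_sq hq0 hq t (c := M s * q t * e)
          (mul_nonneg (mul_nonneg (hM0 s) (hq0 t)) (Real.exp_pos _).le) ?_).trans (by simp)
        have h2 : ∑ a, G s a ^ 2 ≤ Real.exp (-α) * M s * M s := by
          calc ∑ a, G s a ^ 2 ≤ ∑ a, Real.exp (-α) * M s * J s a :=
                Finset.sum_le_sum fun a _ => by
                  rw [sq]; exact mul_le_mul (hGe s a) (hGJ s a) (hG0 s a)
                    (mul_nonneg (Real.exp_pos _).le (hM0 s))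
            _ = _ := by rw [← Finset.mul_sum]
        have h3 : e ^ 2 * Real.exp (-β) = Real.exp (-α) := by
          rw [he, ← Real.exp_nat_mul, ← Real.exp_add]; congr 1; push_cast; ring
        calc q t * ∑ a, G s a ^ 2 ≤ q t * (Real.exp (-α) * M s * M s) :=
              mul_le_mul_of_nonneg_left h2 (hq0 t)
          _ = M s ^ 2 * q t * e ^ 2 * Real.exp (-β) := by rw [← h3]; ring
          _ ≤ M s ^ 2 * q t * e ^ 2 * q t := by
              refine mul_le_mul_of_nonneg_left hb ?_
              have := hq0 t
              positivity
          _ = _ := by ring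
      · rw [if_neg hb]
        refine (sum_ite_eq_sub_mul_abs_le hq0 hq (hG0 s) t).trans ?_
        have h2 : ∑ a, G s a ≤ M s := Finset.sum_le_sum fun a _ => hGJ s a
        have h3 : 0 ≤ M s * q t * e :=
          mul_nonneg (mul_nonneg (hM0 s) (hq0 t)) (Real.exp_pos _).le
        nlinarith [hq0 t, mul_le_mul_of_nonneg_left h2 (hq0 t)]
    have h2 := sum_ite_eq_sub_mul_abs_le hq0 hq (hG'0 s) t
    calc _ ≤ ∑ f : A → T, ((∏ a, q (f a)) *
            |∑ a, ((if f a = t then 1 else 0) - q t) * G s a| + (∏ a, q (f a)) *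
            |∑ a, ((if f a = t then 1 else 0) - q t) * G' s a|) := by
          refine Finset.sum_le_sum fun f _ => ?_
          rw [hsplit, ← mul_add]
          exact mul_le_mul_of_nonneg_left (abs_add_le _ _)
            (Finset.prod_nonneg fun a _ => hq0 _)
      _ ≤ _ := by rw [Finset.sum_add_distrib]; linarith
  calc _ = ∑ s, ∑ t, ∑ f : A → T, (∏ a, q (f a)) *
        |(∑ a, if f a = t then J s a else 0) - M s * q t| := by
        simp only [Finset.mul_sum]
        rw [Finset.sum_comm]
        exact Finset.sum_congr rfl fun s _ => Finset.sum_comm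
    _ ≤ ∑ s, ∑ t, (M s * q t * e + 2 * (M s * (if Real.exp (-β) ≤ q t then 0 else q t)) +
        2 * (q t * ∑ a, G' s a)) :=
        Finset.sum_le_sum fun s _ => Finset.sum_le_sum fun t _ => hst s t
    _ = (∑ s, M s) * (∑ t, q t) * e +
        2 * ((∑ s, M s) * ∑ t, (if Real.exp (-β) ≤ q t then 0 else q t)) +
        2 * ((∑ t, q t) * ∑ s, ∑ a, G' s a) := by
        simp only [Finset.sum_add_distrib, ← Finset.mul_sum, ← Finset.sum_mul]
    _ = _ := by rw [hq, hJ]; ring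

end SoftCovering

/-! ### Basic solutions of linear programs -/

section BasicSolutions

variable {ι κ : Type*} [Fintype ι] [Fintype κ]

/-- A nonnegative vector whose support is too large can be moved, without changing the linear
constraints and without decreasing the objective, to one of smaller support. -/
theorem exists_support_ssubset (A : ι → κ → ℝ) (c : ι → ℝ)
    (hA : ∃ l : κ → ℝ, ∀ i, ∑ j, l j * A i j = 1) {p : ι → ℝ} (hp : ∀ i, 0 ≤ p i)
    (hcard : Fintype.card κ < (Finset.univ.filter fun i => p i ≠ 0).card) :
    ∃ p' : ι → ℝ, (∀ i, 0 ≤ p' i) ∧ (∀ j, ∑ i, p' i * A i j = ∑ i, p i * A i j) ∧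
      ∑ i, p i * c i ≤ ∑ i, p' i * c i ∧
      (Finset.univ.filter fun i => p' i ≠ 0).card <
        (Finset.univ.filter fun i => p i ≠ 0).card := by
  set s := Finset.univ.filter fun i => p i ≠ 0 with hs
  obtain ⟨d, hdA, hdc, hds, k, hk⟩ : ∃ d : ι → ℝ, (∀ j, ∑ i, d i * A i j = 0) ∧
      0 ≤ ∑ i, d i * c i ∧ (∀ i, p i = 0 → d i = 0) ∧ ∃ k, d k ≠ 0 := by
    have hli : ¬ LinearIndependent ℝ (fun i : s => A i) := fun h => by
      have := h.fintype_card_le_finrank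
      rw [Module.finrank_fintype_fun_eq_card, Fintype.card_coe] at this
      omega
    obtain ⟨g, hg, k, hk⟩ := Fintype.not_linearIndependent_iff.1 hli
    set d : ι → ℝ := fun i => if h : i ∈ s then g ⟨i, h⟩ else 0 with hd
    have hsum : ∀ j, ∑ i, d i * A i j = 0 := by
      intro j
      have h1 : ∑ i, d i * A i j = ∑ i ∈ s, d i * A i j := by
        symm
        refine Finset.sum_subset (Finset.subset_univ _) fun i _ hi => ?_
        simp [hd, hi]
      rw [h1, ← Finset.sum_coe_sort]
      have h2 := congrFun hg j
      simpa [hd] using h2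
    have hzero : ∀ i, p i = 0 → d i = 0 := fun i hi => by
      have : i ∉ s := by simp [hs, hi]
      simp [hd, this]
    have hne : d k ≠ 0 := by simpa [hd] using hk
    rcases le_total 0 (∑ i, d i * c i) with h | h
    · exact ⟨d, hsum, h, hzero, k, hne⟩
    · refine ⟨fun i => -d i, fun j => ?_, ?_, fun i hi => ?_, k, ?_⟩
      · simp [hsum j]
      · simpa using h
      · simp [hzero i hi]
      · simpa using hne
  obtain ⟨l, hl⟩ := hA
  have hd0 : ∑ i, d i = 0 := by
    calc ∑ i, d i = ∑ i, d i * ∑ j, l j * A i j := by simp [hl]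
      _ = ∑ j, l j * ∑ i, d i * A i j := by
        simp only [Finset.mul_sum]
        rw [Finset.sum_comm]
        exact Finset.sum_congr rfl fun j _ => Finset.sum_congr rfl fun i _ => by ring
      _ = 0 := by simp [hdA]
  have hneg : (Finset.univ.filter fun i => d i < 0).Nonempty := by
    by_contra h
    rw [Finset.not_nonempty_iff_eq_empty, Finset.filter_eq_empty_iff] at h
    have h' : ∀ i ∈ Finset.univ, 0 ≤ d i := fun i hi => not_lt.1 (h hi)
    exact hk ((Finset.sum_eq_zero_iff_of_nonneg h').1 hd0 k (Finset.mem_univ k))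
  obtain ⟨i₀, hi₀, hmin⟩ := Finset.exists_min_image _ (fun i => p i / (-d i)) hneg
  simp only [Finset.mem_filter, Finset.mem_univ, true_and] at hi₀ hmin
  set r := p i₀ / (-d i₀) with hr
  have hr0 : 0 ≤ r := div_nonneg (hp _) (by linarith)
  refine ⟨fun i => p i + r * d i, fun i => ?_, fun j => ?_, ?_, ?_⟩
  · rcases lt_or_ge (d i) 0 with h | h
    · have := (le_div_iff₀ (by linarith : (0 : ℝ) < -d i)).1 (hmin i h)
      linarith
    · have := hp i
      positivity
  · simp only [add_mul, Finset.sum_add_distrib, mul_assoc, ← Finset.mul_sum, hdA]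
    simp
  · simp only [add_mul, Finset.sum_add_distrib, mul_assoc, ← Finset.mul_sum]
    have := mul_nonneg hr0 hdc
    linarith
  · refine Finset.card_lt_card ⟨fun i hi => ?_, fun h => ?_⟩
    · simp only [Finset.mem_filter, Finset.mem_univ, true_and, hs] at hi ⊢
      intro h0
      exact hi (by rw [h0, hds i h0]; simp)
    · have hi : i₀ ∈ s := by
        simp only [hs, Finset.mem_filter, Finset.mem_univ, true_and]
        exact fun h0 => hi₀.ne (hds i₀ h0)
      have := h hi
      simp only [Finset.mem_filter, Finset.mem_univ, true_and] at this
      apply this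
      rw [hr]
      field_simp [hi₀.ne]
      ring

theorem exists_card_support_le (A : ι → κ → ℝ) (c : ι → ℝ)
    (hA : ∃ l : κ → ℝ, ∀ i, ∑ j, l j * A i j = 1) {p : ι → ℝ} (hp : ∀ i, 0 ≤ p i) :
    ∃ p' : ι → ℝ, (∀ i, 0 ≤ p' i) ∧ (∀ j, ∑ i, p' i * A i j = ∑ i, p i * A i j) ∧
      ∑ i, p i * c i ≤ ∑ i, p' i * c i ∧
      (Finset.univ.filter fun i => p' i ≠ 0).card ≤ Fintype.card κ := by
  induction hN : (Finset.univ.filter fun i => p i ≠ 0).card using Nat.strong_induction_on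
    generalizing p with
  | _ N ih =>
    by_cases h : (Finset.univ.filter fun i => p i ≠ 0).card ≤ Fintype.card κ
    · exact ⟨p, hp, fun _ => rfl, le_rfl, h⟩
    · obtain ⟨p₁, h1, h2, h3, h4⟩ := exists_support_ssubset A c hA hp (not_le.1 h)
      obtain ⟨p₂, h5, h6, h7, h8⟩ := ih _ (hN ▸ h4) h1 rfl
      exact ⟨p₂, h5, fun j => (h6 j).trans (h2 j), h3.trans h7, h8⟩

theorem exists_reindex_fin [Nonempty ι] {p : ι → ℝ} (hp : ∀ i, 0 ≤ p i) {n : ℕ}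
    (hn : (Finset.univ.filter fun i => p i ≠ 0).card ≤ n) :
    ∃ (r : Fin n → ι) (q : Fin n → ℝ), (∀ j, 0 ≤ q j) ∧
      ∀ G : ι → ℝ, ∑ j, q j * G (r j) = ∑ i, p i * G i := by
  set s := Finset.univ.filter fun i => p i ≠ 0 with hs
  let e : s ↪ Fin n := s.equivFin.toEmbedding.trans (Fin.castLEEmb hn)
  refine ⟨Function.extend e (fun i => (i : ι)) (fun _ => Classical.arbitrary ι),
    Function.extend e (fun i => p i) (fun _ => 0), fun j => ?_, fun G => ?_⟩
  · by_cases h : ∃ i, e i = j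
    · obtain ⟨i, rfl⟩ := h
      rw [e.injective.extend_apply]
      exact hp _
    · rw [Function.extend_apply' _ _ _ h]
  · have h1 : ∑ i, p i * G i = ∑ i : s, p i * G i := by
      rw [Finset.sum_coe_sort s fun i => p i * G i]
      symm
      refine Finset.sum_subset (Finset.subset_univ _) fun i _ hi => ?_
      have : p i = 0 := by simpa [hs] using hi
      simp [this]
    rw [h1]
    symm
    refine Finset.sum_of_injOn e (e.injective.injOn) (by simp) (fun j _ hj => ?_) fun i _ => ?_
    · rw [Function.extend_apply', zero_mul]
      rintro ⟨i, hi⟩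
      exact hj ⟨i, by simp, hi⟩
    · rw [e.injective.extend_apply, e.injective.extend_apply]

/-- A linear program over nonnegative vectors has a solution supported on as many points as there
are constraints, and at least as good as any given feasible point. -/
theorem exists_basic_solution [Nonempty ι] (A : ι → κ → ℝ) (c : ι → ℝ)
    (hA : ∃ l : κ → ℝ, ∀ i, ∑ j, l j * A i j = 1) {p : ι → ℝ} (hp : ∀ i, 0 ≤ p i) :
    ∃ (r : Fin (Fintype.card κ) → ι) (q : Fin (Fintype.card κ) → ℝ), (∀ j, 0 ≤ q j) ∧
      (∀ k, ∑ j, q j * A (r j) k = ∑ i, p i * A i k) ∧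
      ∑ i, p i * c i ≤ ∑ j, q j * c (r j) := by
  obtain ⟨p', h1, h2, h3, h4⟩ := exists_card_support_le A c hA hp
  obtain ⟨r, q, hq, h⟩ := exists_reindex_fin h1 h4
  exact ⟨r, q, hq, fun k => (h fun i => A i k).trans (h2 k), by rw [h c]; exact h3⟩

end BasicSolutions

/-! ### Entropies of marginals and relative entropy -/

section Entropy

variable {α β : Type} [Fintype α] [Fintype β]

theorem ent_marg (f : α → β) (p : α → ℝ) :
    ent (marg f p) = -∑ a, p a * Real.log (marg f p (f a)) := by
  have h : ∀ b, Real.negMulLog (marg f p b) =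
      -∑ a, (if f a = b then p a * Real.log (marg f p (f a)) else 0) := by
    intro b
    rw [Real.negMulLog, neg_mul, neg_inj]
    conv_lhs => rw [marg, Finset.sum_mul]
    refine Finset.sum_congr rfl fun a _ => ?_
    split_ifs with hab
    · rw [← hab]; rfl
    · simp
  simp only [ent, h, Finset.sum_neg_distrib]
  rw [Finset.sum_comm]
  simp

/-- The relative entropy of `p` with respect to `q` as a real number. -/
def relEnt (p q : α → ℝ) : ℝ := ∑ a, p a * Real.log (p a / q a)

theorem KL_eq_ofReal_relEnt {p q : α → ℝ} (h : ∀ a, q a = 0 → p a = 0) :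
    KL p q = ENNReal.ofReal (relEnt p q) := if_pos h

theorem sum_marg (f : α → β) (p : α → ℝ) : ∑ b, marg f p b = ∑ a, p a := by
  simp only [marg]
  rw [Finset.sum_comm]
  simp

theorem marg_nonneg {p : α → ℝ} (hp : ∀ a, 0 ≤ p a) (f : α → β) (b : β) : 0 ≤ marg f p b :=
  Finset.sum_nonneg fun a _ => by split_ifs; exacts [hp a, le_rfl]

theorem IsDist.marg {p : α → ℝ} (hp : IsDist p) (f : α → β) : IsDist (marg f p) :=
  ⟨marg_nonneg hp.1 f, (sum_marg f p).trans hp.2⟩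

theorem marg_snd_apply (p : α × β → ℝ) (b : β) : marg Prod.snd p b = ∑ a, p (a, b) := by
  simp only [marg, Fintype.sum_prod_type]
  simp

end Entropy

/-! ### Single-letter schemes without time sharing -/

/-- A law of the auxiliary variable together with an encoding and a decoding kernel. -/
structure Letter (X Y B U : Type) [Fintype Y] [Fintype B] [Fintype U] where
  PU : U → ℝ
  PB : X → U → B → ℝ
  PY : B → U → Y → ℝ
  isDist_PU : IsDist PU
  isDist_PB : ∀ x u, IsDist (PB x u)
  isDist_PY : ∀ b u, IsDist (PY b u)

namespace Letter

variable {X Y B U V : Type} [Fintype X] [Fintype Y] [Fintype B] [Fintype U] [Fintype V]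

/-- The joint law of `((X, Y), (U, B))`. -/
def joint (c : Letter X Y B U) (μ : X → ℝ) (z : (X × Y) × (U × B)) : ℝ :=
  μ z.1.1 * c.PU z.2.1 * c.PB z.1.1 z.2.1 z.2.2 * c.PY z.2.2 z.2.1 z.1.2

/-- The joint law of `(X, Y)`. -/
def out (c : Letter X Y B U) (μ : X → ℝ) (s : X × Y) : ℝ := ∑ h, c.joint μ (s, h)

/-- The randomness gain `H(BU | XY) - H(U)`. -/
def gain (c : Letter X Y B U) (μ : X → ℝ) : ℝ :=
  ∑ z, c.joint μ z * (Real.log (c.out μ z.1) + Real.log (c.PU z.2.1) - Real.log (c.joint μ z))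

theorem joint_nonneg (c : Letter X Y B U) {μ : X → ℝ} (hμ : ∀ x, 0 ≤ μ x)
    (z : (X × Y) × (U × B)) : 0 ≤ c.joint μ z :=
  mul_nonneg (mul_nonneg (mul_nonneg (hμ _) (c.isDist_PU.1 _)) ((c.isDist_PB _ _).1 _))
    ((c.isDist_PY _ _).1 _)

theorem out_nonneg (c : Letter X Y B U) {μ : X → ℝ} (hμ : ∀ x, 0 ≤ μ x) (s : X × Y) :
    0 ≤ c.out μ s :=
  Finset.sum_nonneg fun _ _ => c.joint_nonneg hμ _

theorem joint_le_out (c : Letter X Y B U) {μ : X → ℝ} (hμ : ∀ x, 0 ≤ μ x)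
    (z : (X × Y) × (U × B)) : c.joint μ z ≤ c.out μ z.1 :=
  Finset.single_le_sum (f := fun h => c.joint μ (z.1, h)) (fun _ _ => c.joint_nonneg hμ _)
    (Finset.mem_univ z.2)

theorem sum_kernels (c : Letter X Y B U) {μ : X → ℝ} (hμ : IsDist μ) (u : U) :
    ∑ s : X × Y, ∑ b, μ s.1 * c.PB s.1 u b * c.PY b u s.2 = 1 := by
  rw [Fintype.sum_prod_type]
  have : ∀ x, ∑ y, ∑ b, μ x * c.PB x u b * c.PY b u y = μ x := by
    intro x
    rw [Finset.sum_comm]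
    simp only [← Finset.mul_sum, (c.isDist_PY _ _).2, (c.isDist_PB _ _).2, mul_one]
  simp only [this, hμ.2]

theorem out_eq (c : Letter X Y B U) (μ : X → ℝ) (s : X × Y) :
    c.out μ s = ∑ u, c.PU u * ∑ b, μ s.1 * c.PB s.1 u b * c.PY b u s.2 := by
  simp only [out, joint, Fintype.sum_prod_type, Finset.mul_sum]
  exact Finset.sum_congr rfl fun u _ => Finset.sum_congr rfl fun b _ => by ring

theorem sum_out (c : Letter X Y B U) {μ : X → ℝ} (hμ : IsDist μ) : ∑ s, c.out μ s = 1 := by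
  simp only [out_eq]
  rw [Finset.sum_comm]
  simp only [← Finset.mul_sum, c.sum_kernels hμ, mul_one, c.isDist_PU.2]

theorem sum_joint (c : Letter X Y B U) {μ : X → ℝ} (hμ : IsDist μ) : ∑ z, c.joint μ z = 1 := by
  rw [Fintype.sum_prod_type]
  exact c.sum_out hμ

theorem gain_eq (c : Letter X Y B U) (μ : X → ℝ) :
    c.gain μ = ∑ s, c.out μ s * Real.log (c.out μ s) +
      ∑ u, c.PU u * ∑ s : X × Y, ∑ b,
        Real.negMulLog (μ s.1 * c.PB s.1 u b * c.PY b u s.2) := by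
  have h : ∀ z : (X × Y) × (U × B), c.joint μ z *
      (Real.log (c.out μ z.1) + Real.log (c.PU z.2.1) - Real.log (c.joint μ z)) =
      c.joint μ z * Real.log (c.out μ z.1) + c.PU z.2.1 *
        Real.negMulLog (μ z.1.1 * c.PB z.1.1 z.2.1 z.2.2 * c.PY z.2.2 z.2.1 z.1.2) := by
    intro z
    set k := μ z.1.1 * c.PB z.1.1 z.2.1 z.2.2 * c.PY z.2.2 z.2.1 z.1.2 with hk
    have hj : c.joint μ z = c.PU z.2.1 * k := by rw [joint, hk]; ring
    rw [hj, Real.negMulLog]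
    rcases eq_or_ne (c.PU z.2.1) 0 with h0 | h0
    · simp [h0]
    rcases eq_or_ne k 0 with h1 | h1
    · simp [h1]
    rw [Real.log_mul h0 h1]
    ring
  simp only [gain, h, Finset.sum_add_distrib]
  congr 1
  · rw [Fintype.sum_prod_type]
    exact Finset.sum_congr rfl fun s _ => by simp only [out, Finset.sum_mul]
  · rw [Fintype.sum_prod_type]
    simp only [Fintype.sum_prod_type (α₁ := U), Finset.mul_sum]
    exact Finset.sum_comm

/-- The auxiliary alphabet can be shrunk to `|X| |Y|` elements. -/
theorem exists_card_reduction (c : Letter X Y B U) {μ : X → ℝ} (hμ : IsDist μ) :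
    ∃ c' : Letter X Y B (Fin (Fintype.card (X × Y))),
      c'.out μ = c.out μ ∧ c.gain μ ≤ c'.gain μ := by
  have hne : Nonempty U := by
    by_contra h
    rw [not_nonempty_iff] at h
    simpa using c.isDist_PU.2
  obtain ⟨r, q, hq0, hq, hobj⟩ := exists_basic_solution
    (fun u (s : X × Y) => ∑ b, μ s.1 * c.PB s.1 u b * c.PY b u s.2)
    (fun u => ∑ s : X × Y, ∑ b, Real.negMulLog (μ s.1 * c.PB s.1 u b * c.PY b u s.2))
    ⟨fun _ => 1, fun u => by simpa using c.sum_kernels hμ u⟩ c.isDist_PU.1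
  have hq1 : ∑ j, q j = 1 := by
    have h := Finset.sum_congr (rfl : (Finset.univ : Finset (X × Y)) = _) fun k _ => hq k
    rw [Finset.sum_comm, Finset.sum_comm (s := Finset.univ (α := X × Y))] at h
    simpa only [← Finset.mul_sum, c.sum_kernels hμ, mul_one, c.isDist_PU.2] using h
  let c' : Letter X Y B (Fin (Fintype.card (X × Y))) :=
    { PU := q
      PB := fun x j => c.PB x (r j)
      PY := fun b j => c.PY b (r j)
      isDist_PU := ⟨hq0, hq1⟩
      isDist_PB := fun x j => c.isDist_PB x (r j)
      isDist_PY := fun b j => c.isDist_PY b (r j) }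
  have hout : c'.out μ = c.out μ := by
    funext s
    rw [out_eq, out_eq]
    exact hq s
  refine ⟨c', hout, ?_⟩
  rw [gain_eq, gain_eq, hout]
  exact add_le_add le_rfl hobj

/-! ### Time sharing -/

section TimeSharing

variable (q : V → ℝ) (c : V → Letter X Y B U) (μ : X → ℝ)

/-- The joint law under time sharing. -/
def mix : X × U × V × B × Y → ℝ :=
  seqJoint μ (fun p : U × V => q p.2 * (c p.2).PU p.1)
    (fun p : X × U × V => (c p.2.2).PB p.1 p.2.1) (fun p : B × U × V => (c p.2.2).PY p.1 p.2.1)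

theorem mix_apply (x : X) (u : U) (v : V) (b : B) (y : Y) :
    mix q c μ (x, u, v, b, y) = q v * (c v).joint μ ((x, y), (u, b)) := by
  simp only [mix, seqJoint, joint]; ring

theorem sum_mix_mul (F : X × U × V × B × Y → ℝ) :
    ∑ a, mix q c μ a * F a = ∑ v, q v * ∑ z : (X × Y) × (U × B),
      (c v).joint μ z * F (z.1.1, z.2.1, v, z.2.2, z.1.2) := by
  simp only [Fintype.sum_prod_type, mix_apply, Finset.mul_sum]
  rw [Finset.sum_congr rfl fun x _ => Finset.sum_comm, Finset.sum_comm]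
  refine Finset.sum_congr rfl fun v _ => Finset.sum_congr rfl fun x _ => ?_
  rw [Finset.sum_congr rfl fun u _ => Finset.sum_comm, Finset.sum_comm]
  refine Finset.sum_congr rfl fun y _ => Finset.sum_congr rfl fun u _ =>
    Finset.sum_congr rfl fun b _ => by ring

theorem marg_mix {γ : Type} (f : X × U × V × B × Y → γ) (g : γ) :
    marg f (mix q c μ) g = ∑ v, q v * ∑ z : (X × Y) × (U × B),
      (c v).joint μ z * if f (z.1.1, z.2.1, v, z.2.2, z.1.2) = g then 1 else 0 := by
  rw [← sum_mix_mul q c μ fun a => if f a = g then 1 else 0]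
  simp [marg]

theorem marg_mix_V (hμ : IsDist μ) (v : V) :
    marg (fun a : X × U × V × B × Y => a.2.2.1) (mix q c μ) v = q v := by
  rw [marg_mix, Finset.sum_eq_single v]
  · simp [(c v).sum_joint hμ]
  · intro v' _ h
    simp [h]
  · simp

theorem marg_mix_UV (hμ : IsDist μ) (u : U) (v : V) :
    marg (fun a : X × U × V × B × Y => (a.2.1, a.2.2.1)) (mix q c μ) (u, v) =
      q v * (c v).PU u := by
  rw [marg_mix, Finset.sum_eq_single v]
  · simp only [Prod.mk.injEq, and_true]
    rw [Fintype.sum_prod_type]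
    simp only [Fintype.sum_prod_type (α₁ := U)]
    congr 1
    have h := (c v).sum_kernels hμ u
    calc _ = ∑ s : X × Y, ∑ b, (c v).joint μ (s, (u, b)) := by
          refine Finset.sum_congr rfl fun s _ => ?_
          rw [Finset.sum_eq_single u]
          · simp
          · intro u' _ hu; simp [hu]
          · simp
      _ = (c v).PU u * ∑ s : X × Y, ∑ b, μ s.1 * (c v).PB s.1 u b * (c v).PY b u s.2 := by
          simp only [Finset.mul_sum, joint]
          exact Finset.sum_congr rfl fun s _ => Finset.sum_congr rfl fun b _ => by ring
      _ = _ := by rw [h, mul_one]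
  · intro v' _ h
    simp [h]
  · simp

theorem sum_joint_mul_ite (c : Letter X Y B U) (μ : X → ℝ) (s : X × Y) :
    ∑ z : (X × Y) × (U × B), c.joint μ z * (if z.1 = s then 1 else 0) = c.out μ s := by
  rw [Fintype.sum_prod_type, Finset.sum_eq_single s]
  · simp [out]
  · intro s' _ h; simp [h]
  · simp

theorem marg_mix_XYV (x : X) (y : Y) (v : V) :
    marg (fun a : X × U × V × B × Y => (a.1, a.2.2.2.2, a.2.2.1)) (mix q c μ) (x, y, v) =
      q v * (c v).out μ (x, y) := by
  rw [marg_mix, Finset.sum_eq_single v]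
  · rw [← sum_joint_mul_ite]
    simp [Prod.ext_iff]
  · intro v' _ h
    simp [h]
  · simp

theorem marg_mix_XVY (x : X) (v : V) (y : Y) :
    marg (fun a : X × U × V × B × Y => (a.1, a.2.2.1, a.2.2.2.2)) (mix q c μ) (x, v, y) =
      q v * (c v).out μ (x, y) := by
  rw [marg_mix, Finset.sum_eq_single v]
  · rw [← sum_joint_mul_ite]
    simp [Prod.ext_iff]
  · intro v' _ h
    simp [h]
  · simp

theorem marg_mix_all (x : X) (u : U) (v : V) (b : B) (y : Y) :
    marg (fun a : X × U × V × B × Y => ((a.2.2.2.1, a.2.1), (a.1, a.2.2.2.2, a.2.2.1)))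
      (mix q c μ) ((b, u), (x, y, v)) = mix q c μ (x, u, v, b, y) := by
  rw [marg, Finset.sum_eq_single (x, u, v, b, y)]
  · simp
  · rintro ⟨x', u', v', b', y'⟩ _ h
    rw [if_neg]
    rintro h'
    simp only [Prod.mk.injEq] at h'
    obtain ⟨⟨rfl, rfl⟩, rfl, rfl, rfl⟩ := h'
    exact h rfl
  · simp

/-- Time sharing averages the randomness gain. -/
theorem condEnt_mix_sub (hq : ∀ v, 0 ≤ q v) (hμ : IsDist μ) :
    condEnt (fun a : X × U × V × B × Y => (a.2.2.2.1, a.2.1))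
        (fun a => (a.1, a.2.2.2.2, a.2.2.1)) (mix q c μ) -
      condEnt (fun a : X × U × V × B × Y => a.2.1) (fun a => a.2.2.1) (mix q c μ) =
      ∑ v, q v * (c v).gain μ := by
  simp only [condEnt, ent_marg, sum_mix_mul]
  simp only [marg_mix_all, marg_mix_XYV, marg_mix_UV q c μ hμ, marg_mix_V q c μ hμ, mix_apply]
  simp only [← Finset.sum_neg_distrib, ← Finset.sum_sub_distrib]
  refine Finset.sum_congr rfl fun v _ => ?_
  rcases (hq v).eq_or_lt with h0 | h0
  · simp [← h0]
  simp only [← mul_neg, ← mul_sub, ← Finset.sum_neg_distrib, ← Finset.sum_sub_distrib, gain]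
  congr 1
  refine Finset.sum_congr rfl fun z _ => ?_
  rcases eq_or_ne ((c v).joint μ z) 0 with h1 | h1
  · simp [h1]
  have h2 : (c v).out μ z.1 ≠ 0 := by
    have := (c v).joint_le_out hμ.1 z
    have h3 := lt_of_le_of_ne ((c v).joint_nonneg hμ.1 z) h1.symm
    linarith
  have h3 : (c v).PU z.2.1 ≠ 0 := by
    intro h; apply h1; simp [joint, h]
  rw [Real.log_mul h0.ne' h1, Real.log_mul h0.ne' h2, Real.log_mul h0.ne' h3]
  ring

theorem marg_snd_mix (v : V) :
    marg Prod.snd (fun p : U × V => q p.2 * (c p.2).PU p.1) v = q v := by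
  rw [marg_snd_apply]
  simp [← Finset.mul_sum, (c v).isDist_PU.2]

theorem relEnt_mix (π : X × Y → ℝ) :
    relEnt (marg (fun a : X × U × V × B × Y => (a.1, a.2.2.1, a.2.2.2.2)) (mix q c μ))
      (fun r : X × V × Y => marg Prod.snd (fun p : U × V => q p.2 * (c p.2).PU p.1) r.2.1 *
        π (r.1, r.2.2)) = ∑ v, q v * relEnt ((c v).out μ) π := by
  simp only [relEnt, Fintype.sum_prod_type, marg_mix_XVY, marg_snd_mix, Finset.mul_sum]
  rw [Finset.sum_comm]
  refine Finset.sum_congr rfl fun v _ => Finset.sum_congr rfl fun x _ =>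
    Finset.sum_congr rfl fun y _ => ?_
  rcases eq_or_ne (q v) 0 with h | h
  · simp [h]
  · rw [mul_div_mul_left _ _ h, mul_assoc]

end TimeSharing

end Letter

/-! ### Splitting off the last coordinate of a pair of sequences -/

section PairSnoc

variable {α β : Type} {n : ℕ}

/-- Append one coordinate to each of two sequences. -/
def pairSnoc : ((Fin n → α) × (Fin n → β)) × (α × β) ≃ (Fin (n + 1) → α) × (Fin (n + 1) → β) where
  toFun z := (Fin.snoc (α := fun _ => α) z.1.1 z.2.1, Fin.snoc (α := fun _ => β) z.1.2 z.2.2)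
  invFun f := ((fun i => f.1 i.castSucc, fun i => f.2 i.castSucc), (f.1 (Fin.last n), f.2 (Fin.last n)))
  left_inv z := by simp
  right_inv f := by
    refine Prod.ext ?_ ?_ <;> funext i <;> refine Fin.lastCases ?_ (fun j => ?_) i <;> simp

theorem sum_pairSnoc [Fintype α] [Fintype β] (F : (Fin (n + 1) → α) × (Fin (n + 1) → β) → ℝ) :
    ∑ f, F f = ∑ p, ∑ s, F (pairSnoc (p, s)) := by
  rw [← Fintype.sum_prod_type' (f := fun p s => F (pairSnoc (p, s)))]
  exact (Equiv.sum_comp pairSnoc F).symm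

theorem snoc_congr {w w' : Fin n → α} {a a' : α} {k : Fin n} (h : ∀ i, i ≤ k → w i = w' i) :
    ∀ i, i ≤ k.castSucc → Fin.snoc (α := fun _ => α) w a i = Fin.snoc (α := fun _ => α) w' a' i := by
  intro i
  refine Fin.lastCases (fun hi => ?_) (fun j hj => ?_) i
  · exact absurd hi (not_le.2 (Fin.castSucc_lt_last k))
  · simpa using h j (by simpa using hj)

theorem snoc_congr_lt {w w' : Fin n → α} {a a' : α} {k : Fin n} (h : ∀ i, i < k → w i = w' i) :
    ∀ i, i < k.castSucc → Fin.snoc (α := fun _ => α) w a i = Fin.snoc (α := fun _ => α) w' a' i := by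
  intro i
  refine Fin.lastCases (fun hi => ?_) (fun j hj => ?_) i
  · exact absurd hi (not_lt.2 (Fin.castSucc_lt_last k).le)
  · simpa using h j (by simpa using hj)

theorem snoc_congr_last {w : Fin n → α} {a a' : α} :
    ∀ i, i < Fin.last n → Fin.snoc (α := fun _ => α) w a i = Fin.snoc (α := fun _ => α) w a' i := by
  intro i
  refine Fin.lastCases (fun hi => ?_) (fun j hj => ?_) i
  · exact absurd hi (lt_irrefl _)
  · simp

end PairSnoc

/-! ### The joint law of a sequential code -/

namespace SeqCode

variable {W X Y B : Type} [Fintype W] [Fintype X] [Fintype Y] [Fintype B] {n : ℕ}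

/-- The joint law of `((X^n, Y^n), (W^n, B^n))`. -/
def law (C : SeqCode W X Y B n) (PW : W → ℝ) (μ : X → ℝ) (p : (Fin n → X) × (Fin n → Y))
    (h : (Fin n → W) × (Fin n → B)) : ℝ :=
  (∏ k, μ (p.1 k)) * ((∏ k, PW (h.1 k)) * (∏ k, C.enc k h.1 p.1 h.2 (h.2 k)) *
    ∏ k, C.dec k h.1 h.2 p.2 (p.2 k))

/-- The joint law of `(X^n, Y^n)`. -/
def out (C : SeqCode W X Y B n) (PW : W → ℝ) (μ : X → ℝ) (p : (Fin n → X) × (Fin n → Y)) : ℝ :=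
  ∑ h, C.law PW μ p h

theorem out_eq (C : SeqCode W X Y B n) (PW : W → ℝ) (μ : X → ℝ)
    (p : (Fin n → X) × (Fin n → Y)) :
    C.out PW μ p = (∏ i, μ (p.1 i)) * C.channel PW p.1 p.2 := by
  simp only [out, law, channel, Fintype.sum_prod_type, Finset.mul_sum]

variable {PW : W → ℝ} {μ : X → ℝ}

theorem law_nonneg (C : SeqCode W X Y B n) (hPW : IsDist PW) (hμ : IsDist μ) (p h) :
    0 ≤ C.law PW μ p h :=
  mul_nonneg (Finset.prod_nonneg fun _ _ => hμ.1 _)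
    (mul_nonneg (mul_nonneg (Finset.prod_nonneg fun _ _ => hPW.1 _)
      (Finset.prod_nonneg fun _ _ => (C.enc_dist _ _ _ _).1 _))
      (Finset.prod_nonneg fun _ _ => (C.dec_dist _ _ _ _).1 _))

theorem out_nonneg (C : SeqCode W X Y B n) (hPW : IsDist PW) (hμ : IsDist μ) (p) :
    0 ≤ C.out PW μ p :=
  Finset.sum_nonneg fun _ _ => C.law_nonneg hPW hμ _ _

theorem law_le_out (C : SeqCode W X Y B n) (hPW : IsDist PW) (hμ : IsDist μ) (p h) :
    C.law PW μ p h ≤ C.out PW μ p :=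
  Finset.single_le_sum (f := fun h => C.law PW μ p h) (fun _ _ => C.law_nonneg hPW hμ _ _)
    (Finset.mem_univ h)

/-- The restriction of a code to all epochs but the last. -/
def init (C : SeqCode W X Y B (n + 1)) (d : (W × X) × (B × Y)) : SeqCode W X Y B n where
  enc k w x b := C.enc k.castSucc (Fin.snoc (α := fun _ => W) w d.1.1)
    (Fin.snoc (α := fun _ => X) x d.1.2) (Fin.snoc (α := fun _ => B) b d.2.1)
  dec k w b y := C.dec k.castSucc (Fin.snoc (α := fun _ => W) w d.1.1)
    (Fin.snoc (α := fun _ => B) b d.2.1) (Fin.snoc (α := fun _ => Y) y d.2.2)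
  enc_dist _ _ _ _ := C.enc_dist _ _ _ _
  dec_dist _ _ _ _ := C.dec_dist _ _ _ _
  enc_causal _ _ _ _ _ _ _ hw hx hb :=
    C.enc_causal _ _ _ _ _ _ _ (snoc_congr hw) (snoc_congr hx) (snoc_congr_lt hb)
  dec_causal _ _ _ _ _ _ _ hw hb hy :=
    C.dec_causal _ _ _ _ _ _ _ (snoc_congr hw) (snoc_congr hb) (snoc_congr_lt hy)

/-- The encoding kernel at the last epoch. -/
def lastEnc (C : SeqCode W X Y B (n + 1)) (d : (W × X) × (B × Y)) (x : Fin n → X)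
    (h : (Fin n → W) × (Fin n → B)) (x' : X) (w' : W) : B → ℝ :=
  C.enc (Fin.last n) (Fin.snoc (α := fun _ => W) h.1 w') (Fin.snoc (α := fun _ => X) x x')
    (Fin.snoc (α := fun _ => B) h.2 d.2.1)

/-- The decoding kernel at the last epoch. -/
def lastDec (C : SeqCode W X Y B (n + 1)) (d : (W × X) × (B × Y)) (y : Fin n → Y)
    (h : (Fin n → W) × (Fin n → B)) (w' : W) (b' : B) : Y → ℝ :=
  C.dec (Fin.last n) (Fin.snoc (α := fun _ => W) h.1 w') (Fin.snoc (α := fun _ => B) h.2 b')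
    (Fin.snoc (α := fun _ => Y) y d.2.2)

theorem law_pairSnoc (C : SeqCode W X Y B (n + 1)) (d : (W × X) × (B × Y))
    (p : (Fin n → X) × (Fin n → Y)) (s : X × Y) (h : (Fin n → W) × (Fin n → B)) (g : W × B) :
    C.law PW μ (pairSnoc (p, s)) (pairSnoc (h, g)) = (C.init d).law PW μ p h *
      (μ s.1 * PW g.1 * C.lastEnc d p.1 h s.1 g.1 g.2 * C.lastDec d p.2 h g.1 g.2 s.2) := by
  have henc : ∀ k : Fin n, C.enc k.castSucc (Fin.snoc (α := fun _ => W) h.1 g.1)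
      (Fin.snoc (α := fun _ => X) p.1 s.1) (Fin.snoc (α := fun _ => B) h.2 g.2) =
      (C.init d).enc k h.1 p.1 h.2 := fun k =>
    C.enc_causal _ _ _ _ _ _ _ (snoc_congr fun _ _ => rfl) (snoc_congr fun _ _ => rfl)
      (snoc_congr_lt fun _ _ => rfl)
  have hdec : ∀ k : Fin n, C.dec k.castSucc (Fin.snoc (α := fun _ => W) h.1 g.1)
      (Fin.snoc (α := fun _ => B) h.2 g.2) (Fin.snoc (α := fun _ => Y) p.2 s.2) =
      (C.init d).dec k h.1 h.2 p.2 := fun k =>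
    C.dec_causal _ _ _ _ _ _ _ (snoc_congr fun _ _ => rfl) (snoc_congr fun _ _ => rfl)
      (snoc_congr_lt fun _ _ => rfl)
  have henc' : C.enc (Fin.last n) (Fin.snoc (α := fun _ => W) h.1 g.1)
      (Fin.snoc (α := fun _ => X) p.1 s.1) (Fin.snoc (α := fun _ => B) h.2 g.2) =
      C.lastEnc d p.1 h s.1 g.1 :=
    C.enc_causal _ _ _ _ _ _ _ (fun _ _ => rfl) (fun _ _ => rfl) snoc_congr_last
  have hdec' : C.dec (Fin.last n) (Fin.snoc (α := fun _ => W) h.1 g.1)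
      (Fin.snoc (α := fun _ => B) h.2 g.2) (Fin.snoc (α := fun _ => Y) p.2 s.2) =
      C.lastDec d p.2 h g.1 g.2 :=
    C.dec_causal _ _ _ _ _ _ _ (fun _ _ => rfl) (fun _ _ => rfl) snoc_congr_last
  simp only [law, pairSnoc, Equiv.coe_fn_mk, Fin.prod_univ_castSucc, Fin.snoc_castSucc,
    Fin.snoc_last, henc, hdec, henc', hdec']
  ring

theorem sum_last_kernels (C : SeqCode W X Y B (n + 1)) (hμ : IsDist μ)
    (d : (W × X) × (B × Y)) (p : (Fin n → X) × (Fin n → Y)) (h : (Fin n → W) × (Fin n → B))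
    (w' : W) :
    ∑ s : X × Y, ∑ b' : B, μ s.1 * PW w' * C.lastEnc d p.1 h s.1 w' b' *
      C.lastDec d p.2 h w' b' s.2 = PW w' := by
  rw [Fintype.sum_prod_type]
  have : ∀ x, ∑ y, ∑ b', μ x * PW w' * C.lastEnc d p.1 h x w' b' * C.lastDec d p.2 h w' b' y =
      μ x * PW w' := by
    intro x
    rw [Finset.sum_comm]
    simp only [lastEnc, lastDec, ← Finset.mul_sum, (C.dec_dist _ _ _ _).2,
      (C.enc_dist _ _ _ _).2, mul_one]
  simp only [this, ← Finset.sum_mul, hμ.2, one_mul]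

theorem sum_law_pairSnoc (C : SeqCode W X Y B (n + 1)) (hμ : IsDist μ)
    (d : (W × X) × (B × Y)) (p : (Fin n → X) × (Fin n → Y)) (h : (Fin n → W) × (Fin n → B))
    (φ : W → ℝ) :
    ∑ s, ∑ g : W × B, C.law PW μ (pairSnoc (p, s)) (pairSnoc (h, g)) * φ g.1 =
      (C.init d).law PW μ p h * ∑ w', PW w' * φ w' := by
  simp only [C.law_pairSnoc d]
  rw [Finset.sum_comm, Fintype.sum_prod_type, Finset.mul_sum]
  refine Finset.sum_congr rfl fun w' _ => ?_
  rw [Finset.sum_comm]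
  rw [← C.sum_last_kernels (PW := PW) hμ d p h w']
  simp only [Finset.mul_sum, Finset.sum_mul]
  exact Finset.sum_congr rfl fun s _ => Finset.sum_congr rfl fun b _ => by ring

theorem sum_out_pairSnoc (C : SeqCode W X Y B (n + 1)) (hPW : IsDist PW) (hμ : IsDist μ)
    (d : (W × X) × (B × Y)) (p : (Fin n → X) × (Fin n → Y)) :
    ∑ s, C.out PW μ (pairSnoc (p, s)) = (C.init d).out PW μ p := by
  simp only [out, sum_pairSnoc (α := W) (β := B)]
  rw [Finset.sum_comm]
  refine Finset.sum_congr rfl fun h _ => ?_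
  simpa [hPW.2] using C.sum_law_pairSnoc (PW := PW) hμ d p h fun _ => 1

theorem sum_out (C : SeqCode W X Y B n) (hPW : IsDist PW) (hμ : IsDist μ)
    (d : (W × X) × (B × Y)) : ∑ p, C.out PW μ p = 1 := by
  induction n with
  | zero => simp [out, law]
  | succ n ih =>
    rw [sum_pairSnoc]
    simp only [C.sum_out_pairSnoc hPW hμ d]
    exact ih (C.init d)

end SeqCode

/-! ### The converse -/

namespace SeqCode

variable {W X Y B : Type} [Fintype W] [Fintype X] [Fintype Y] [Fintype B] {n : ℕ}
variable {PW : W → ℝ} {μ : X → ℝ}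

/-- The single-letter scheme seen at the last epoch, given the past inputs and outputs. -/
def step (C : SeqCode W X Y B (n + 1)) (hPW : IsDist PW) (hμ : IsDist μ)
    (d : (W × X) × (B × Y)) (p : (Fin n → X) × (Fin n → Y))
    (hS : (C.init d).out PW μ p ≠ 0) :
    Letter X Y B (((Fin n → W) × (Fin n → B)) × W) where
  PU u := (C.init d).law PW μ p u.1 / (C.init d).out PW μ p * PW u.2
  PB x u := C.lastEnc d p.1 u.1 x u.2
  PY b u := C.lastDec d p.2 u.1 u.2 b
  isDist_PU := by
    refine ⟨fun u => mul_nonneg (div_nonneg ((C.init d).law_nonneg hPW hμ _ _)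
      ((C.init d).out_nonneg hPW hμ _)) (hPW.1 _), ?_⟩
    rw [Fintype.sum_prod_type]
    simp only [← Finset.mul_sum, hPW.2, mul_one, ← Finset.sum_div]
    exact div_self hS
  isDist_PB _ _ := C.enc_dist _ _ _ _
  isDist_PY _ _ := C.dec_dist _ _ _ _

theorem step_joint (C : SeqCode W X Y B (n + 1)) (hPW : IsDist PW) (hμ : IsDist μ)
    (d : (W × X) × (B × Y)) (p : (Fin n → X) × (Fin n → Y))
    (hS : (C.init d).out PW μ p ≠ 0) (s : X × Y) (h : (Fin n → W) × (Fin n → B)) (g : W × B) :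
    C.law PW μ (pairSnoc (p, s)) (pairSnoc (h, g)) =
      (C.init d).out PW μ p * (C.step hPW hμ d p hS).joint μ (s, ((h, g.1), g.2)) := by
  rw [C.law_pairSnoc d, Letter.joint, step]
  field_simp

theorem step_out (C : SeqCode W X Y B (n + 1)) (hPW : IsDist PW) (hμ : IsDist μ)
    (d : (W × X) × (B × Y)) (p : (Fin n → X) × (Fin n → Y))
    (hS : (C.init d).out PW μ p ≠ 0) (s : X × Y) :
    C.out PW μ (pairSnoc (p, s)) =
      (C.init d).out PW μ p * (C.step hPW hμ d p hS).out μ s := by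
  rw [out, sum_pairSnoc]
  simp only [C.step_joint hPW hμ d p hS, ← Finset.mul_sum, Letter.out, Fintype.sum_prod_type]

theorem out_pairSnoc_eq_zero (C : SeqCode W X Y B (n + 1)) (hPW : IsDist PW) (hμ : IsDist μ)
    (d : (W × X) × (B × Y)) (p : (Fin n → X) × (Fin n → Y))
    (hS : (C.init d).out PW μ p = 0) (s : X × Y) : C.out PW μ (pairSnoc (p, s)) = 0 := by
  have h := C.sum_out_pairSnoc hPW hμ d p
  rw [hS, Finset.sum_eq_zero_iff_of_nonneg fun _ _ => C.out_nonneg hPW hμ _] at h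
  exact h s (Finset.mem_univ s)

/-- The product law on pairs of sequences. -/
def prodLaw (π : X × Y → ℝ) (n : ℕ) (p : (Fin n → X) × (Fin n → Y)) : ℝ :=
  ∏ i, π (p.1 i, p.2 i)

theorem prodLaw_pairSnoc (π : X × Y → ℝ) (p : (Fin n → X) × (Fin n → Y)) (s : X × Y) :
    prodLaw π (n + 1) (pairSnoc (p, s)) = prodLaw π n p * π s := by
  simp [prodLaw, pairSnoc, Fin.prod_univ_castSucc]

/-- The entropy of the shared histories given inputs and outputs. -/
def histEnt (C : SeqCode W X Y B n) (PW : W → ℝ) (μ : X → ℝ) : ℝ :=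
  ∑ p, ∑ h, C.law PW μ p h * (Real.log (C.out PW μ p) - Real.log (C.law PW μ p h))

theorem histEnt_nonneg (C : SeqCode W X Y B n) (hPW : IsDist PW) (hμ : IsDist μ) :
    0 ≤ C.histEnt PW μ := by
  refine Finset.sum_nonneg fun p _ => Finset.sum_nonneg fun h _ => ?_
  rcases (C.law_nonneg hPW hμ p h).eq_or_lt with h0 | h0
  · simp [← h0]
  · exact mul_nonneg h0.le (sub_nonneg.2 (Real.log_le_log h0 (C.law_le_out hPW hμ p h)))

section Step

theorem init_absCont (C : SeqCode W X Y B (n + 1)) (hPW : IsDist PW) (hμ : IsDist μ)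
    (d : (W × X) × (B × Y)) {π : X × Y → ℝ} (hac : ∀ p, prodLaw π (n + 1) p = 0 → C.out PW μ p = 0)
    (p : (Fin n → X) × (Fin n → Y)) (hp : prodLaw π n p = 0) : (C.init d).out PW μ p = 0 := by
  rw [← C.sum_out_pairSnoc hPW hμ d p]
  refine Finset.sum_eq_zero fun s _ => hac _ ?_
  rw [prodLaw_pairSnoc, hp, zero_mul]

variable (C : SeqCode W X Y B (n + 1)) (hPW : IsDist PW) (hμ : IsDist μ)
  (d : (W × X) × (B × Y)) {π : X × Y → ℝ}

theorem step_absCont (hac : ∀ p, prodLaw π (n + 1) p = 0 → C.out PW μ p = 0)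
    (p : (Fin n → X) × (Fin n → Y)) (hS : (C.init d).out PW μ p ≠ 0) (s : X × Y)
    (hs : π s = 0) : (C.step hPW hμ d p hS).out μ s = 0 := by
  have h := hac (pairSnoc (p, s)) (by rw [prodLaw_pairSnoc, hs, mul_zero])
  rw [C.step_out hPW hμ d p hS] at h
  exact (mul_eq_zero.1 h).resolve_left hS

/-- The increments of divergence and randomness at the last epoch. -/
def stepPoint (π : X × Y → ℝ) (p : (Fin n → X) × (Fin n → Y)) : ℝ × ℝ :=
  if hS : (C.init d).out PW μ p ≠ 0 then
    (relEnt ((C.step hPW hμ d p hS).out μ) π, (C.step hPW hμ d p hS).gain μ) else 0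

theorem relEnt_succ (hac : ∀ p, prodLaw π (n + 1) p = 0 → C.out PW μ p = 0) :
    relEnt (C.out PW μ) (prodLaw π (n + 1)) =
      relEnt ((C.init d).out PW μ) (prodLaw π n) +
        ∑ p, (C.init d).out PW μ p * (C.stepPoint hPW hμ d π p).1 := by
  rw [relEnt, sum_pairSnoc, relEnt, ← Finset.sum_add_distrib]
  refine Finset.sum_congr rfl fun p _ => ?_
  by_cases hS : (C.init d).out PW μ p = 0
  · simp [hS, C.out_pairSnoc_eq_zero hPW hμ d p hS]
  rw [stepPoint, dif_pos hS]
  simp only [C.step_out hPW hμ d p hS, prodLaw_pairSnoc]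
  conv_lhs =>
    enter [2, s]
    rw [show (C.init d).out PW μ p * (C.step hPW hμ d p hS).out μ s *
      Real.log ((C.init d).out PW μ p * (C.step hPW hμ d p hS).out μ s /
        (prodLaw π n p * π s)) =
      (C.init d).out PW μ p * Real.log ((C.init d).out PW μ p / prodLaw π n p) *
        (C.step hPW hμ d p hS).out μ s + (C.init d).out PW μ p *
        ((C.step hPW hμ d p hS).out μ s * Real.log ((C.step hPW hμ d p hS).out μ s / π s)) by
      by_cases h0 : (C.step hPW hμ d p hS).out μ s = 0
      · simp [h0]
      have h1 : π s ≠ 0 := fun h => h0 (C.step_absCont hPW hμ d hac p hS s h)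
      have h2 : prodLaw π n p ≠ 0 := fun h => hS (C.init_absCont hPW hμ d hac p h)
      rw [mul_div_mul_comm, Real.log_mul (div_ne_zero hS h2) (div_ne_zero h0 h1)]
      ring]
  rw [Finset.sum_add_distrib, ← Finset.mul_sum, ← Finset.mul_sum, Letter.sum_out _ hμ, mul_one]
  rfl

theorem histEnt_succ :
    C.histEnt PW μ = (C.init d).histEnt PW μ + ent PW +
        ∑ p, (C.init d).out PW μ p * (C.stepPoint hPW hμ d π p).2 := by
  have hent : ent PW = ∑ p, (C.init d).out PW μ p * ent PW := by
    rw [← Finset.sum_mul, (C.init d).sum_out hPW hμ d, one_mul]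
  rw [hent, histEnt, sum_pairSnoc, histEnt, ← Finset.sum_add_distrib, ← Finset.sum_add_distrib]
  refine Finset.sum_congr rfl fun p _ => ?_
  by_cases hS : (C.init d).out PW μ p = 0
  · have h1 : ∀ h, (C.init d).law PW μ p h = 0 := fun h =>
      le_antisymm (hS ▸ (C.init d).law_le_out hPW hμ p h) ((C.init d).law_nonneg hPW hμ p h)
    have h2 : ∀ s h, C.law PW μ (pairSnoc (p, s)) h = 0 := fun s h =>
      le_antisymm (C.out_pairSnoc_eq_zero hPW hμ d p hS s ▸ C.law_le_out hPW hμ _ h)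
        (C.law_nonneg hPW hμ _ h)
    simp [hS, h1, h2]
  rw [stepPoint, dif_pos hS]
  set S := (C.init d).out PW μ p with hSdef
  set c := C.step hPW hμ d p hS with hc
  have key : ∀ s h g, C.law PW μ (pairSnoc (p, s)) (pairSnoc (h, g)) *
      (Real.log (C.out PW μ (pairSnoc (p, s))) -
        Real.log (C.law PW μ (pairSnoc (p, s)) (pairSnoc (h, g)))) =
      C.law PW μ (pairSnoc (p, s)) (pairSnoc (h, g)) *
        (Real.log S - Real.log ((C.init d).law PW μ p h) - Real.log (PW g.1)) +
      S * (c.joint μ (s, ((h, g.1), g.2)) * (Real.log (c.out μ s) + Real.log (c.PU (h, g.1)) -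
        Real.log (c.joint μ (s, ((h, g.1), g.2))))) := by
    intro s h g
    have hj := C.step_joint hPW hμ d p hS s h g
    have ho := C.step_out hPW hμ d p hS s
    rw [← hc] at hj ho
    rw [hj, ho]
    by_cases h0 : c.joint μ (s, ((h, g.1), g.2)) = 0
    · simp [h0]
    have h1 : c.out μ s ≠ 0 := fun h1 => h0 (le_antisymm
      (h1 ▸ c.joint_le_out hμ.1 _) (c.joint_nonneg hμ.1 _))
    have hPU : c.PU (h, g.1) = (C.init d).law PW μ p h / S * PW g.1 := rfl
    have h2 : c.PU (h, g.1) ≠ 0 := by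
      intro h2; apply h0; simp [Letter.joint, h2]
    have h3 : (C.init d).law PW μ p h ≠ 0 := by
      intro h3; apply h2; simp [hPU, h3]
    have h4 : PW g.1 ≠ 0 := by
      intro h3; apply h2; simp [hPU, h3]
    rw [Real.log_mul hS h0, Real.log_mul hS h1, hPU, Real.log_mul (div_ne_zero h3 hS) h4,
      Real.log_div h3 hS]
    ring
  simp only [sum_pairSnoc (α := W) (β := B), key, Finset.sum_add_distrib, ← Finset.mul_sum]
  congr 1
  · rw [Finset.sum_comm]
    have hsum : S * ent PW = ∑ h, (C.init d).law PW μ p h * ent PW := by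
      rw [← Finset.sum_mul]; rfl
    rw [hsum, ← Finset.sum_add_distrib]
    refine Finset.sum_congr rfl fun h _ => ?_
    refine (C.sum_law_pairSnoc (PW := PW) hμ d p h fun w =>
      Real.log S - Real.log ((C.init d).law PW μ p h) - Real.log (PW w)).trans ?_
    rw [← mul_add]
    congr 1
    simp only [mul_sub, Finset.sum_sub_distrib, ← Finset.sum_mul, hPW.2, one_mul, ent,
      Real.negMulLog, neg_mul, Finset.sum_neg_distrib]
    ring
  · rw [Letter.gain, Fintype.sum_prod_type (α₁ := X × Y)]
    refine congrArg _ (Finset.sum_congr rfl fun s _ => ?_)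
    rw [Fintype.sum_prod_type (α₁ := ((Fin n → W) × (Fin n → B)) × W),
      Fintype.sum_prod_type (α₁ := (Fin n → W) × (Fin n → B))]
    refine Finset.sum_congr rfl fun h _ => ?_
    rw [Fintype.sum_prod_type]

end Step

end SeqCode

section Region

variable {W X Y B : Type} [Fintype W] [Fintype X] [Fintype Y] [Fintype B]

/-- The pairs (divergence, randomness gain) achieved by single-letter schemes. -/
def letterRegion (X Y B : Type) [Fintype X] [Fintype Y] [Fintype B] (μ : X → ℝ)
    (π : X × Y → ℝ) : Set (ℝ × ℝ) :=
  {z | ∃ c : Letter X Y B (Fin (Fintype.card (X × Y))), (∀ s, π s = 0 → c.out μ s = 0) ∧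
    z.1 = relEnt (c.out μ) π ∧ z.2 ≤ c.gain μ}

namespace SeqCode

variable {n : ℕ} {PW : W → ℝ} {μ : X → ℝ} {π : X × Y → ℝ}

theorem sum_stepPoint_mem (C : SeqCode W X Y B (n + 1)) (hPW : IsDist PW) (hμ : IsDist μ)
    (d : (W × X) × (B × Y)) (hac : ∀ p, prodLaw π (n + 1) p = 0 → C.out PW μ p = 0) :
    ∑ p, (C.init d).out PW μ p • C.stepPoint hPW hμ d π p ∈
      convexHull ℝ (letterRegion X Y B μ π) := by
  rw [← Finset.sum_filter_of_ne (p := fun p => (C.init d).out PW μ p ≠ 0)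
    fun p _ hp h0 => hp (by rw [h0, zero_smul])]
  refine (convex_convexHull ℝ _).sum_mem (fun p _ => (C.init d).out_nonneg hPW hμ p) ?_ ?_
  · rw [Finset.sum_filter_ne_zero]
    exact (C.init d).sum_out hPW hμ d
  · intro p hp
    have hS := (Finset.mem_filter.1 hp).2
    refine subset_convexHull ℝ _ ?_
    obtain ⟨c', hout, hgain⟩ := (C.step hPW hμ d p hS).exists_card_reduction hμ
    refine ⟨c', fun s hs => ?_, ?_, ?_⟩
    · rw [hout]; exact C.step_absCont hPW hμ d hac p hS s hs
    · rw [hout, stepPoint, dif_pos hS]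
    · rw [stepPoint, dif_pos hS]; exact hgain

theorem exists_hull_points (C : SeqCode W X Y B n) (hPW : IsDist PW) (hμ : IsDist μ)
    (d : (W × X) × (B × Y)) (hac : ∀ p, prodLaw π n p = 0 → C.out PW μ p = 0) :
    ∃ z : Fin n → ℝ × ℝ, (∀ i, z i ∈ convexHull ℝ (letterRegion X Y B μ π)) ∧
      ∑ i, z i = (relEnt (C.out PW μ) (prodLaw π n), C.histEnt PW μ - n * ent PW) := by
  induction n with
  | zero =>
    refine ⟨Fin.elim0, fun i => i.elim0, ?_⟩
    simp [relEnt, histEnt, out, law, prodLaw, Prod.ext_iff]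
  | succ n ih =>
    obtain ⟨z, hz, hsum⟩ := ih (C.init d) (C.init_absCont hPW hμ d hac)
    refine ⟨Fin.snoc (α := fun _ => ℝ × ℝ) z
      (∑ p, (C.init d).out PW μ p • C.stepPoint hPW hμ d π p), ?_, ?_⟩
    · refine Fin.lastCases ?_ fun i => ?_
      · simpa using C.sum_stepPoint_mem hPW hμ d hac
      · simpa using hz i
    · rw [Fin.sum_univ_castSucc]
      simp only [Fin.snoc_castSucc, Fin.snoc_last, hsum]
      refine Prod.ext ?_ ?_
      · simp [C.relEnt_succ hPW hμ d hac, Prod.fst_sum]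
      · simp only [C.histEnt_succ hPW hμ d (π := π), Prod.snd_add, Prod.snd_sum, Prod.smul_snd,
          smul_eq_mul, Nat.cast_add, Nat.cast_one]
        ring

theorem average_mem_hull (C : SeqCode W X Y B n) (hn : n ≠ 0) (hPW : IsDist PW) (hμ : IsDist μ)
    (d : (W × X) × (B × Y)) (hac : ∀ p, prodLaw π n p = 0 → C.out PW μ p = 0) :
    (relEnt (C.out PW μ) (prodLaw π n) / n, C.histEnt PW μ / n - ent PW) ∈
      convexHull ℝ (letterRegion X Y B μ π) := by
  obtain ⟨z, hz, hsum⟩ := C.exists_hull_points hPW hμ d hac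
  have hn' : (n : ℝ) ≠ 0 := by exact_mod_cast hn
  have h := (convex_convexHull ℝ (letterRegion X Y B μ π)).sum_mem (t := Finset.univ)
    (w := fun _ : Fin n => (n : ℝ)⁻¹) (z := z) (fun _ _ => by positivity)
    (by simp [hn']) fun i _ => hz i
  rw [← Finset.smul_sum, hsum] at h
  convert h using 1
  refine Prod.ext ?_ ?_
  · simp [div_eq_inv_mul]
  · simp only [Prod.smul_snd, smul_eq_mul]
    field_simp

end SeqCode

theorem exists_mix_of_mem_hull {μ : X → ℝ} {π : X × Y → ℝ} {a b : ℝ}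
    (h : (a, b) ∈ convexHull ℝ (letterRegion X Y B μ π)) :
    ∃ (q : Fin (Fintype.card (Fin 2)) → ℝ)
      (c : Fin (Fintype.card (Fin 2)) → Letter X Y B (Fin (Fintype.card (X × Y)))),
      IsDist q ∧ (∀ v s, π s = 0 → (c v).out μ s = 0) ∧
      ∑ v, q v * relEnt ((c v).out μ) π ≤ a ∧ b ≤ ∑ v, q v * (c v).gain μ := by
  rw [mem_convexHull_iff_exists_fintype] at h
  obtain ⟨ι, _, w, z, hw0, hw1, hz, hsum⟩ := h
  have hne : Nonempty ι := by
    by_contra h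
    rw [not_nonempty_iff] at h
    simp at hw1
  choose c hac hcost hgain using hz
  obtain ⟨r, q, hq0, hq, hobj⟩ := exists_basic_solution
    (fun i (k : Fin 2) => if k = 0 then 1 else (c i).gain μ) (fun i => -(z i).1)
    ⟨fun k => if k = 0 then 1 else 0, fun i => by simp⟩ hw0
  have h0 := hq 0
  have h1 := hq 1
  simp only [if_true, mul_one, one_ne_zero, if_false, hw1] at h0 h1
  refine ⟨q, fun v => c (r v), ⟨hq0, h0⟩, fun v => hac (r v), ?_, ?_⟩
  · have ha := congrArg Prod.fst hsum
    simp only [Prod.fst_sum, Prod.smul_fst, smul_eq_mul] at ha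
    simp only [mul_neg, Finset.sum_neg_distrib, neg_le_neg_iff, hcost] at hobj
    simp only [hcost] at ha
    rw [← ha]
    exact hobj
  · have hb := congrArg Prod.snd hsum
    simp only [Prod.snd_sum, Prod.smul_snd, smul_eq_mul] at hb
    rw [h1, ← hb]
    exact Finset.sum_le_sum fun i _ => mul_le_mul_of_nonneg_left (hgain i) (hw0 i)

theorem sInf_psiSetBdd_le {π : X × Y → ℝ} (hπ : IsDist π) {t a : ℝ} {m l : ℕ}
    (hm : m ≤ 2 * Fintype.card X * Fintype.card Y) (hl : l ≤ 2) {q : Fin l → ℝ}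
    (hq : IsDist q) (c : Fin l → Letter X Y B (Fin m))
    (hac : ∀ v s, π s = 0 → (c v).out (marg Prod.fst π) s = 0)
    (ha : ∑ v, q v * relEnt ((c v).out (marg Prod.fst π)) π ≤ a)
    (ht : -t ≤ ∑ v, q v * (c v).gain (marg Prod.fst π)) :
    sInf (psiSetBdd X Y B π t) ≤ ENNReal.ofReal a := by
  refine le_trans (sInf_le ⟨m, l, hm, hl, fun p => q p.2 * (c p.2).PU p.1,
    fun p => (c p.2.2).PB p.1 p.2.1, fun p => (c p.2.2).PY p.1 p.2.1, ?_, ?_, ?_, ?_, rfl⟩) ?_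
  · refine ⟨fun p => mul_nonneg (hq.1 _) ((c _).isDist_PU.1 _), ?_⟩
    rw [Fintype.sum_prod_type, Finset.sum_comm]
    simp [← Finset.mul_sum, (c _).isDist_PU.2, hq.2]
  · exact fun p => (c _).isDist_PB _ _
  · exact fun p => (c _).isDist_PY _ _
  · have h := Letter.condEnt_mix_sub q c (marg Prod.fst π) hq.1 (hπ.marg _)
    rw [Letter.mix] at h
    linarith
  · rw [← Letter.mix, KL_eq_ofReal_relEnt, Letter.relEnt_mix]
    · exact ENNReal.ofReal_le_ofReal ha
    · rintro ⟨x, v, y⟩ h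
      rw [Letter.marg_snd_mix] at h
      rw [Letter.marg_mix_XVY]
      rcases mul_eq_zero.1 h with h | h
      · rw [h, zero_mul]
      · rw [hac v _ h, mul_zero]

/-- The single-letter expression bounds the normalized divergence of every code. -/
theorem sInf_psiSetBdd_le_GammaN {PW : W → ℝ} (hPW : IsDist PW) {π : X × Y → ℝ} (hπ : IsDist π)
    (d : (W × X) × (B × Y)) {n : ℕ} (hn : n ≠ 0) :
    sInf (psiSetBdd X Y B π (ent PW)) ≤ GammaN W X Y B PW π n / n := by
  rw [ENNReal.le_div_iff_mul_le (.inl (by exact_mod_cast hn)) (.inl (ENNReal.natCast_ne_top n))]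
  refine le_sInf ?_
  rintro _ ⟨C, rfl⟩
  have hμ : IsDist (marg Prod.fst π) := hπ.marg _
  simp only [← SeqCode.out_eq]
  change _ ≤ KL (C.out PW (marg Prod.fst π)) (SeqCode.prodLaw π n)
  by_cases hac : ∀ p, SeqCode.prodLaw π n p = 0 → C.out PW (marg Prod.fst π) p = 0
  swap
  · rw [KL, if_neg hac]; exact le_top
  rw [KL_eq_ofReal_relEnt hac]
  obtain ⟨q, c, hq, hacc, hcost, hgain⟩ :=
    exists_mix_of_mem_hull (C.average_mem_hull hn hPW hμ d hac)
  have hn' : (0 : ℝ) < n := by exact_mod_cast Nat.pos_of_ne_zero hn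
  have h := sInf_psiSetBdd_le hπ (t := ent PW) (by
    rw [Fintype.card_prod]; nlinarith [Nat.zero_le (Fintype.card X * Fintype.card Y)])
    (Fintype.card_fin 2).le hq c hacc hcost
    (le_trans (by linarith [div_nonneg (C.histEnt_nonneg hPW hμ) hn'.le]) hgain)
  refine (mul_le_mul_left h _).trans (le_of_eq ?_)
  rw [← ENNReal.ofReal_natCast, ← ENNReal.ofReal_mul' hn'.le, div_mul_cancel₀ _ hn'.ne']

end Region

/-! ### Concatenation of codes -/

section PairAppend

variable {α β : Type} {n m : ℕ}

/-- Concatenate two pairs of sequences. -/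
def pairAppend : ((Fin n → α) × (Fin n → β)) × ((Fin m → α) × (Fin m → β)) ≃
    (Fin (n + m) → α) × (Fin (n + m) → β) where
  toFun z := (Fin.append z.1.1 z.2.1, Fin.append z.1.2 z.2.2)
  invFun f := ((fun i => f.1 (Fin.castAdd m i), fun i => f.2 (Fin.castAdd m i)),
    (fun i => f.1 (Fin.natAdd n i), fun i => f.2 (Fin.natAdd n i)))
  left_inv z := by simp
  right_inv f := by
    refine Prod.ext ?_ ?_ <;> funext i <;> refine Fin.addCases (fun j => ?_) (fun j => ?_) i <;>
      simp

theorem sum_pairAppend [Fintype α] [Fintype β]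
    (F : (Fin (n + m) → α) × (Fin (n + m) → β) → ℝ) :
    ∑ f, F f = ∑ p, ∑ s, F (pairAppend (p, s)) := by
  rw [← Fintype.sum_prod_type' (f := fun p s => F (pairAppend (p, s)))]
  exact (Equiv.sum_comp pairAppend F).symm

theorem castAdd_lt_natAdd (i : Fin n) (j : Fin m) : Fin.castAdd m i < Fin.natAdd n j := by
  rw [Fin.lt_def]
  exact i.2.trans_le (Nat.le_add_right n j)

end PairAppend

namespace SeqCode

variable {W X Y B T : Type} [Fintype W] [Fintype X] [Fintype Y] [Fintype B] {n m : ℕ}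
variable {PW : W → ℝ} {μ : X → ℝ} {π : X × Y → ℝ}

/-- Run `C` and then a code selected by the shared history. -/
def bind (C : SeqCode W X Y B n) (σ : (Fin n → W) × (Fin n → B) → T)
    (D : T → SeqCode W X Y B m) : SeqCode W X Y B (n + m) where
  enc k w x b := Fin.addCases (motive := fun _ => B → ℝ)
    (fun i => C.enc i (fun j => w (Fin.castAdd m j)) (fun j => x (Fin.castAdd m j))
      fun j => b (Fin.castAdd m j))
    (fun i => (D (σ (fun j => w (Fin.castAdd m j), fun j => b (Fin.castAdd m j)))).enc i
      (fun j => w (Fin.natAdd n j)) (fun j => x (Fin.natAdd n j))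
      fun j => b (Fin.natAdd n j)) k
  dec k w b y := Fin.addCases (motive := fun _ => Y → ℝ)
    (fun i => C.dec i (fun j => w (Fin.castAdd m j)) (fun j => b (Fin.castAdd m j))
      fun j => y (Fin.castAdd m j))
    (fun i => (D (σ (fun j => w (Fin.castAdd m j), fun j => b (Fin.castAdd m j)))).dec i
      (fun j => w (Fin.natAdd n j)) (fun j => b (Fin.natAdd n j))
      fun j => y (Fin.natAdd n j)) k
  enc_dist k w x b := by
    refine Fin.addCases (fun i => ?_) (fun i => ?_) k
    · simpa using C.enc_dist _ _ _ _
    · simpa using (D _).enc_dist _ _ _ _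
  dec_dist k w b y := by
    refine Fin.addCases (fun i => ?_) (fun i => ?_) k
    · simpa using C.dec_dist _ _ _ _
    · simpa using (D _).dec_dist _ _ _ _
  enc_causal k w w' x x' b b' := by
    refine Fin.addCases (fun i => ?_) (fun i => ?_) k
    · intro hw hx hb
      simp only [Fin.addCases_left]
      refine C.enc_causal _ _ _ _ _ _ _ (fun j hj => hw _ ?_) (fun j hj => hx _ ?_)
        fun j hj => hb _ ?_
      all_goals exact hj
    · intro hw hx hb
      simp only [Fin.addCases_right]
      have h1 : (fun j => w (Fin.castAdd m j)) = fun j => w' (Fin.castAdd m j) :=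
        funext fun j => hw _ (castAdd_lt_natAdd j i).le
      have h2 : (fun j => b (Fin.castAdd m j)) = fun j => b' (Fin.castAdd m j) :=
        funext fun j => hb _ (castAdd_lt_natAdd j i)
      rw [h1, h2]
      refine (D _).enc_causal _ _ _ _ _ _ _ (fun j hj => hw _ ?_) (fun j hj => hx _ ?_)
        fun j hj => hb _ ?_
      all_goals simpa using hj
  dec_causal k w w' b b' y y' := by
    refine Fin.addCases (fun i => ?_) (fun i => ?_) k
    · intro hw hb hy
      simp only [Fin.addCases_left]
      refine C.dec_causal _ _ _ _ _ _ _ (fun j hj => hw _ ?_) (fun j hj => hb _ ?_)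
        fun j hj => hy _ ?_
      all_goals exact hj
    · intro hw hb hy
      simp only [Fin.addCases_right]
      have h1 : (fun j => w (Fin.castAdd m j)) = fun j => w' (Fin.castAdd m j) :=
        funext fun j => hw _ (castAdd_lt_natAdd j i).le
      have h2 : (fun j => b (Fin.castAdd m j)) = fun j => b' (Fin.castAdd m j) :=
        funext fun j => hb _ (castAdd_lt_natAdd j i).le
      rw [h1, h2]
      refine (D _).dec_causal _ _ _ _ _ _ _ (fun j hj => hw _ ?_) (fun j hj => hb _ ?_)
        fun j hj => hy _ ?_
      all_goals simpa using hj

theorem law_bind (C : SeqCode W X Y B n) (σ : (Fin n → W) × (Fin n → B) → T)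
    (D : T → SeqCode W X Y B m) (p : (Fin n → X) × (Fin n → Y)) (p' : (Fin m → X) × (Fin m → Y))
    (h : (Fin n → W) × (Fin n → B)) (h' : (Fin m → W) × (Fin m → B)) :
    (C.bind σ D).law PW μ (pairAppend (p, p')) (pairAppend (h, h')) =
      C.law PW μ p h * (D (σ h)).law PW μ p' h' := by
  simp only [law, bind, pairAppend, Equiv.coe_fn_mk, Fin.prod_univ_add, Fin.append_left,
    Fin.append_right, Fin.addCases_left, Fin.addCases_right]
  ring

theorem prodLaw_pairAppend (p : (Fin n → X) × (Fin n → Y)) (p' : (Fin m → X) × (Fin m → Y)) :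
    prodLaw π (n + m) (pairAppend (p, p')) = prodLaw π n p * prodLaw π m p' := by
  simp [prodLaw, pairAppend, Fin.prod_univ_add]

theorem relEnt_pairAppend {P : (Fin (n + m) → X) × (Fin (n + m) → Y) → ℝ}
    {M : (Fin n → X) × (Fin n → Y) → ℝ} {M' : (Fin m → X) × (Fin m → Y) → ℝ}
    (hP : ∀ p p', P (pairAppend (p, p')) = M p * M' p') (hM : ∑ p, M p = 1)
    (hM' : ∑ p, M' p = 1) (hac : ∀ p, prodLaw π n p = 0 → M p = 0)
    (hac' : ∀ p, prodLaw π m p = 0 → M' p = 0) :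
    relEnt P (prodLaw π (n + m)) = relEnt M (prodLaw π n) + relEnt M' (prodLaw π m) := by
  rw [relEnt, sum_pairAppend]
  have key : ∀ p p', M p * M' p' * Real.log (M p * M' p' / (prodLaw π n p * prodLaw π m p')) =
      M p * Real.log (M p / prodLaw π n p) * M' p' +
      M p * (M' p' * Real.log (M' p' / prodLaw π m p')) := by
    intro p p'
    by_cases h1 : M p = 0
    · simp [h1]
    by_cases h2 : M' p' = 0
    · simp [h2]
    rw [mul_div_mul_comm, Real.log_mul (div_ne_zero h1 fun h => h1 (hac p h))
      (div_ne_zero h2 fun h => h2 (hac' p' h))]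
    ring
  simp only [hP, prodLaw_pairAppend, key, Finset.sum_add_distrib, ← Finset.mul_sum,
    ← Finset.sum_mul, hM, hM', mul_one, one_mul]
  rfl

/-- Every sequence pair forbidden by `π` has probability zero. -/
def IsSafe (C : SeqCode W X Y B n) (PW : W → ℝ) (μ : X → ℝ) (π : X × Y → ℝ) : Prop :=
  ∀ p, prodLaw π n p = 0 → ∀ h, C.law PW μ p h = 0

theorem IsSafe.out_eq_zero {C : SeqCode W X Y B n} (hC : C.IsSafe PW μ π)
    (p : (Fin n → X) × (Fin n → Y)) (hp : prodLaw π n p = 0) : C.out PW μ p = 0 :=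
  Finset.sum_eq_zero fun h _ => hC p hp h

theorem IsSafe.bind {C : SeqCode W X Y B n} (hC : C.IsSafe PW μ π)
    (σ : (Fin n → W) × (Fin n → B) → T) {D : T → SeqCode W X Y B m}
    (hD : ∀ t, (D t).IsSafe PW μ π) : (C.bind σ D).IsSafe PW μ π := by
  intro p hp h
  obtain ⟨⟨p, p'⟩, rfl⟩ := pairAppend.surjective p
  obtain ⟨⟨h, h'⟩, rfl⟩ := pairAppend.surjective h
  rw [prodLaw_pairAppend] at hp
  rw [law_bind]
  rcases mul_eq_zero.1 hp with hp | hp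
  · rw [hC p hp, zero_mul]
  · rw [hD _ p' hp, mul_zero]

/-- The joint law of inputs, outputs and a state computed from the shared history. -/
def stateLaw (C : SeqCode W X Y B n) (PW : W → ℝ) (μ : X → ℝ)
    (σ : (Fin n → W) × (Fin n → B) → T) (p : (Fin n → X) × (Fin n → Y)) (t : T) : ℝ :=
  ∑ h, if σ h = t then C.law PW μ p h else 0

theorem stateLaw_nonneg (C : SeqCode W X Y B n) (hPW : IsDist PW) (hμ : IsDist μ)
    (σ : (Fin n → W) × (Fin n → B) → T) (p t) : 0 ≤ C.stateLaw PW μ σ p t :=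
  Finset.sum_nonneg fun h _ => by split_ifs; exacts [C.law_nonneg hPW hμ p h, le_rfl]

theorem sum_stateLaw [Fintype T] (C : SeqCode W X Y B n)
    (σ : (Fin n → W) × (Fin n → B) → T) (p) : ∑ t, C.stateLaw PW μ σ p t = C.out PW μ p := by
  simp only [stateLaw]
  rw [Finset.sum_comm]
  simp [out]

theorem stateLaw_bind [Fintype T] {T' : Type} (C : SeqCode W X Y B n)
    (σ : (Fin n → W) × (Fin n → B) → T) (D : T → SeqCode W X Y B m)
    (τ : T → (Fin m → W) × (Fin m → B) → T') (p p') (t' : T') :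
    (C.bind σ D).stateLaw PW μ
        (fun h => τ (σ (pairAppend.symm h).1) (pairAppend.symm h).2) (pairAppend (p, p')) t' =
      ∑ t, C.stateLaw PW μ σ p t * (D t).stateLaw PW μ (τ t) p' t' := by
  rw [stateLaw, sum_pairAppend]
  simp only [Equiv.symm_apply_apply, law_bind]
  have h1 : ∑ t, C.stateLaw PW μ σ p t * (D t).stateLaw PW μ (τ t) p' t' =
      ∑ h, ∑ t, if σ h = t then C.law PW μ p h * (D t).stateLaw PW μ (τ t) p' t' else 0 := by
    rw [Finset.sum_comm]
    refine Finset.sum_congr rfl fun t _ => ?_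
    conv_lhs => rw [stateLaw, Finset.sum_mul]
    simp only [ite_mul, zero_mul]
  rw [h1]
  refine Finset.sum_congr rfl fun h _ => ?_
  rw [Finset.sum_ite_eq, if_pos (Finset.mem_univ _), stateLaw, Finset.mul_sum]
  simp only [mul_ite, mul_zero]

/-- Running a further block adds the simulation errors. -/
theorem sum_abs_stateLaw_bind_le {T' : Type} [Fintype T] [Fintype T'] (C : SeqCode W X Y B n)
    (hPW : IsDist PW) (hμ : IsDist μ) (d : (W × X) × (B × Y))
    (σ : (Fin n → W) × (Fin n → B) → T) (D : T → SeqCode W X Y B m)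
    (τ : T → (Fin m → W) × (Fin m → B) → T')
    {M : (Fin n → X) × (Fin n → Y) → ℝ} {M' : (Fin m → X) × (Fin m → Y) → ℝ}
    {q : T → ℝ} {q' : T' → ℝ} (hM : IsDist M) {δ ε : ℝ}
    (hδ : ∑ p, ∑ t, |C.stateLaw PW μ σ p t - M p * q t| ≤ δ)
    (hε : ∑ p', ∑ t', |(∑ t, q t * (D t).stateLaw PW μ (τ t) p' t') - M' p' * q' t'| ≤ ε) :
    ∑ p, ∑ p', ∑ t', |(C.bind σ D).stateLaw PW μ
        (fun h => τ (σ (pairAppend.symm h).1) (pairAppend.symm h).2) (pairAppend (p, p')) t' -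
        M p * M' p' * q' t'| ≤ δ + ε := by
  have h1 : ∀ p p' t', |(C.bind σ D).stateLaw PW μ
        (fun h => τ (σ (pairAppend.symm h).1) (pairAppend.symm h).2) (pairAppend (p, p')) t' -
        M p * M' p' * q' t'| ≤
      ∑ t, |C.stateLaw PW μ σ p t - M p * q t| * (D t).stateLaw PW μ (τ t) p' t' +
      M p * |(∑ t, q t * (D t).stateLaw PW μ (τ t) p' t') - M' p' * q' t'| := by
    intro p p' t'
    rw [stateLaw_bind]
    have h2 : ∑ t, C.stateLaw PW μ σ p t * (D t).stateLaw PW μ (τ t) p' t' -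
        M p * M' p' * q' t' =
        ∑ t, (C.stateLaw PW μ σ p t - M p * q t) * (D t).stateLaw PW μ (τ t) p' t' +
        M p * ((∑ t, q t * (D t).stateLaw PW μ (τ t) p' t') - M' p' * q' t') := by
      rw [mul_sub, Finset.mul_sum]
      simp only [sub_mul, Finset.sum_sub_distrib, mul_assoc]
      ring
    rw [h2]
    refine (abs_add_le _ _).trans (add_le_add ((Finset.abs_sum_le_sum_abs _ _).trans
      (Finset.sum_le_sum fun t _ => ?_)) ?_)
    · rw [abs_mul, abs_of_nonneg ((D t).stateLaw_nonneg hPW hμ _ _ _)]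
    · rw [abs_mul, abs_of_nonneg (hM.1 p)]
  have hD : ∀ t, ∑ p', ∑ t', (D t).stateLaw PW μ (τ t) p' t' = 1 := fun t => by
    simp only [sum_stateLaw, (D t).sum_out hPW hμ d]
  refine (Finset.sum_le_sum fun p _ => Finset.sum_le_sum fun p' _ =>
    Finset.sum_le_sum fun t' _ => h1 p p' t').trans ?_
  simp only [Finset.sum_add_distrib]
  refine add_le_add (le_trans (le_of_eq ?_) hδ) (le_trans (le_of_eq ?_) hε)
  · refine Finset.sum_congr rfl fun p _ => ?_
    rw [Finset.sum_congr rfl fun p' _ => Finset.sum_comm, Finset.sum_comm]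
    refine Finset.sum_congr rfl fun t _ => ?_
    simp only [← Finset.mul_sum, hD, mul_one]
  · simp only [← Finset.mul_sum, ← Finset.sum_mul, hM.2, one_mul]

/-- Use the single-letter schemes `c i` one after the other, with auxiliary sequence `u`. -/
def memoryless {U : Type} [Fintype U] (c : Fin n → Letter X Y B U) (u : Fin n → U) :
    SeqCode W X Y B n where
  enc k _ x _ := (c k).PB (x k) (u k)
  dec k _ b _ := (c k).PY (b k) (u k)
  enc_dist k _ _ _ := (c k).isDist_PB _ _
  dec_dist k _ _ _ := (c k).isDist_PY _ _
  enc_causal k _ _ x x' _ _ _ hx _ := by rw [hx k le_rfl]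
  dec_causal k _ _ b b' _ _ _ hb _ := by rw [hb k le_rfl]

theorem law_memoryless {U : Type} [Fintype U] (c : Fin n → Letter X Y B U) (u : Fin n → U)
    (p : (Fin n → X) × (Fin n → Y)) (h : (Fin n → W) × (Fin n → B)) :
    (memoryless c u).law PW μ p h = ∏ i, PW (h.1 i) * (μ (p.1 i) * (c i).PB (p.1 i) (u i) (h.2 i) *
      (c i).PY (h.2 i) (u i) (p.2 i)) := by
  simp only [law, memoryless, Finset.prod_mul_distrib]
  ring

end SeqCode

/-! ### Subadditivity -/

section Subadditive

variable {W X Y B : Type} [Fintype W] [Fintype X] [Fintype Y] [Fintype B]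
  {PW : W → ℝ} {π : X × Y → ℝ}

theorem GammaN_le {n : ℕ} (C : SeqCode W X Y B n)
    (hC : ∀ p, SeqCode.prodLaw π n p = 0 → C.out PW (marg Prod.fst π) p = 0) :
    GammaN W X Y B PW π n ≤
      ENNReal.ofReal (relEnt (C.out PW (marg Prod.fst π)) (SeqCode.prodLaw π n)) := by
  refine sInf_le ⟨C, ?_⟩
  rw [← KL_eq_ofReal_relEnt hC]
  simp only [← SeqCode.out_eq]
  rfl

theorem GammaN_add_le (hPW : IsDist PW) (hπ : IsDist π) (d : (W × X) × (B × Y)) (n m : ℕ) :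
    GammaN W X Y B PW π (n + m) ≤ GammaN W X Y B PW π n + GammaN W X Y B PW π m := by
  have hμ : IsDist (marg Prod.fst π) := hπ.marg _
  conv_rhs => rw [GammaN, GammaN, ENNReal.sInf_add]
  refine le_iInf₂ fun a ha => ?_
  rw [ENNReal.add_sInf]
  refine le_iInf₂ fun b hb => ?_
  obtain ⟨C, rfl⟩ := ha
  obtain ⟨D, rfl⟩ := hb
  simp only [← SeqCode.out_eq]
  change _ ≤ KL (C.out PW (marg Prod.fst π)) (SeqCode.prodLaw π n) +
    KL (D.out PW (marg Prod.fst π)) (SeqCode.prodLaw π m)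
  by_cases hC : ∀ p, SeqCode.prodLaw π n p = 0 → C.out PW (marg Prod.fst π) p = 0
  swap
  · rw [KL, if_neg hC]; simp
  by_cases hD : ∀ p, SeqCode.prodLaw π m p = 0 → D.out PW (marg Prod.fst π) p = 0
  swap
  · rw [KL_eq_ofReal_relEnt hC, KL, if_neg hD]; simp
  rw [KL_eq_ofReal_relEnt hC, KL_eq_ofReal_relEnt hD]
  have hout : ∀ p p', (C.bind (fun _ => ()) fun _ => D).out PW (marg Prod.fst π)
      (pairAppend (p, p')) = C.out PW (marg Prod.fst π) p * D.out PW (marg Prod.fst π) p' := by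
    intro p p'
    simp only [SeqCode.out, sum_pairAppend (α := W) (β := B), SeqCode.law_bind,
      Finset.sum_mul_sum]
  refine (GammaN_le (C.bind (fun _ => ()) fun _ => D) ?_).trans
    (le_trans (ENNReal.ofReal_le_ofReal (le_of_eq ?_)) ENNReal.ofReal_add_le)
  · intro p hp
    obtain ⟨⟨p, p'⟩, rfl⟩ := pairAppend.surjective p
    rw [SeqCode.prodLaw_pairAppend] at hp
    rw [hout]
    rcases mul_eq_zero.1 hp with hp | hp
    · rw [hC p hp, zero_mul]
    · rw [hD p' hp, mul_zero]
  · exact SeqCode.relEnt_pairAppend hout (C.sum_out hPW hμ d) (D.sum_out hPW hμ d) hC hD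

end Subadditive

/-! ### Soft covering for product laws -/

section ProductCovering

variable {ι κ S A T : Type} [Fintype ι] [Fintype κ] [Fintype S] [Fintype A] [Fintype T]
  [DecidableEq ι] [DecidableEq κ]

theorem sum_pi_prod_equiv (F : (ι → S × A) → ℝ) :
    ∑ g, F g = ∑ s : ι → S, ∑ a : ι → A, F fun i => (s i, a i) := by
  rw [← Fintype.sum_prod_type' (f := fun (s : ι → S) (a : ι → A) => F fun i => (s i, a i))]
  exact Equiv.sum_comp (Equiv.arrowProdEquivProdArrow ι (fun _ => S) fun _ => A)
    fun z => F fun i => (z.1 i, z.2 i)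

/-- The conditional surprisal of the second component given the first. -/
def condSurprisal (J : S × A → ℝ) (z : S × A) : ℝ :=
  Real.log (∑ a, J (z.1, a)) - Real.log (J z)

theorem sum_not_typical_le {J : ι → S × A → ℝ} (hJ : ∀ i, IsDist (J i)) {v : ℝ}
    (hv : ∀ i, ∑ z, J i z * condSurprisal (J i) z ^ 2 ≤ v) {ε : ℝ} (hε : 0 < ε) :
    ∑ s : ι → S, ∑ a : ι → A, (if ∏ i, J i (s i, a i) ≤
      Real.exp (-((∑ i, ∑ z, J i z * condSurprisal (J i) z) - ε)) *
        ∏ i, ∑ a', J i (s i, a') then 0 else ∏ i, J i (s i, a i)) ≤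
      Fintype.card ι * v / ε ^ 2 := by
  have h := sum_pi_prod_tail_le (p := J) (φ := fun i z => -condSurprisal (J i) z)
    (fun i => (hJ i).1) (fun i => (hJ i).2) (by simpa using hv) hε
  refine le_trans ?_ h
  rw [sum_pi_prod_equiv]
  refine Finset.sum_le_sum fun s _ => Finset.sum_le_sum fun a _ => ?_
  have hnn : 0 ≤ ∏ i, J i (s i, a i) := Finset.prod_nonneg fun i _ => (hJ i).1 _
  rcases hnn.eq_or_lt with h0 | h0
  · rw [← h0]; simp
  have hJpos : ∀ i, 0 < J i (s i, a i) := fun i => lt_of_le_of_ne ((hJ i).1 _) fun hi =>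
    h0.ne' (Finset.prod_eq_zero (Finset.mem_univ i) hi.symm)
  have hMpos : ∀ i, 0 < ∑ a', J i (s i, a') := fun i => (hJpos i).trans_le
    (Finset.single_le_sum (f := fun a' => J i (s i, a')) (fun _ _ => (hJ i).1 _)
      (Finset.mem_univ (a i)))
  by_cases h1 : ∏ i, J i (s i, a i) ≤
      Real.exp (-((∑ i, ∑ z, J i z * condSurprisal (J i) z) - ε)) *
        ∏ i, ∑ a', J i (s i, a')
  · rw [if_pos h1]; split_ifs; exacts [hnn, le_rfl]
  rw [if_neg h1, if_pos]
  rw [not_le] at h1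
  have h2 := Real.log_lt_log (mul_pos (Real.exp_pos _) (Finset.prod_pos fun i _ => hMpos i)) h1
  rw [Real.log_mul (Real.exp_pos _).ne' (Finset.prod_pos fun i _ => hMpos i).ne', Real.log_exp,
    Real.log_prod fun i _ => (hMpos i).ne', Real.log_prod fun i _ => (hJpos i).ne'] at h2
  simp only [mul_neg, Finset.sum_neg_distrib, condSurprisal, Finset.sum_sub_distrib] at h2 ⊢
  linarith

theorem sum_small_mass_le {q : κ → T → ℝ} (hq : ∀ j, IsDist (q j)) {v : ℝ}
    (hv : ∀ j, ∑ t, q j t * Real.log (q j t) ^ 2 ≤ v) {ε : ℝ} (hε : 0 < ε) :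
    ∑ t : κ → T, (if Real.exp (-((∑ j, ent (q j)) + ε)) ≤ ∏ j, q j (t j) then 0
      else ∏ j, q j (t j)) ≤ Fintype.card κ * v / ε ^ 2 := by
  have h := sum_pi_prod_tail_le (p := q) (φ := fun j t => -Real.log (q j t))
    (fun j => (hq j).1) (fun j => (hq j).2) (by simpa using hv) hε
  refine le_trans (Finset.sum_le_sum fun t _ => ?_) h
  have hnn : 0 ≤ ∏ j, q j (t j) := Finset.prod_nonneg fun i _ => (hq i).1 _
  rcases hnn.eq_or_lt with h0 | h0
  · rw [← h0]; simp
  have hpos : ∀ j, 0 < q j (t j) := fun j => lt_of_le_of_ne ((hq j).1 _) fun hi =>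
    h0.ne' (Finset.prod_eq_zero (Finset.mem_univ j) hi.symm)
  by_cases h1 : Real.exp (-((∑ j, ent (q j)) + ε)) ≤ ∏ j, q j (t j)
  · rw [if_pos h1]; split_ifs; exacts [hnn, le_rfl]
  rw [if_neg h1, if_pos]
  rw [not_le] at h1
  have h2 := Real.log_lt_log h0 h1
  rw [Real.log_exp, Real.log_prod fun i _ => (hpos i).ne'] at h2
  simp only [mul_neg, ent, Real.negMulLog, neg_mul, Finset.sum_neg_distrib] at h2 ⊢
  linarith

theorem exists_map_product_covering {J : ι → S × A → ℝ} (hJ : ∀ i, IsDist (J i))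
    {q : κ → T → ℝ} (hq : ∀ j, IsDist (q j)) {v w : ℝ}
    (hv : ∀ i, ∑ z, J i z * condSurprisal (J i) z ^ 2 ≤ v)
    (hw : ∀ j, ∑ t, q j t * Real.log (q j t) ^ 2 ≤ w) {ε : ℝ} (hε : 0 < ε)
    (hgap : (∑ j, ent (q j)) + 3 * ε ≤ ∑ i, ∑ z, J i z * condSurprisal (J i) z) :
    ∃ f : (ι → A) → κ → T, ∑ s : ι → S, ∑ t,
      |marg f (fun a => ∏ i, J i (s i, a i)) t - (∏ i, ∑ a, J i (s i, a)) * ∏ j, q j (t j)| ≤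
      Real.exp (-ε / 2) + 2 * (Fintype.card ι * v / ε ^ 2) +
        2 * (Fintype.card κ * w / ε ^ 2) := by
  have hsum : ∀ s : ι → S, ∑ a : ι → A, ∏ i, J i (s i, a i) = ∏ i, ∑ a, J i (s i, a) :=
    fun s => (Fintype.prod_sum fun i a => J i (s i, a)).symm
  obtain ⟨f, hf⟩ := exists_map_soft_covering
    (J := fun (s : ι → S) (a : ι → A) => ∏ i, J i (s i, a i))
    (fun s a => Finset.prod_nonneg fun i _ => (hJ i).1 _)
    (by rw [← sum_pi_prod_equiv fun g => ∏ i, J i (g i)]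
        exact sum_pi_prod_eq_one fun i => (hJ i).2)
    (q := fun t : κ → T => ∏ j, q j (t j))
    (fun t => Finset.prod_nonneg fun i _ => (hq i).1 _)
    (sum_pi_prod_eq_one fun i => (hq i).2)
    ((∑ i, ∑ z, J i z * condSurprisal (J i) z) - ε) ((∑ j, ent (q j)) + ε)
  refine ⟨f, ?_⟩
  simp only [hsum] at hf
  refine le_trans (le_of_eq rfl) (hf.trans (add_le_add (add_le_add (Real.exp_le_exp.2 ?_)
    (mul_le_mul_of_nonneg_left (sum_not_typical_le hJ hv hε) zero_le_two))
    (mul_le_mul_of_nonneg_left (sum_small_mass_le hq hw hε) zero_le_two)))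
  linarith

end ProductCovering

/-! ### One block of a code -/

namespace Letter

variable {W X Y B U : Type} [Fintype W] [Fintype X] [Fintype Y] [Fintype B] [Fintype U]

/-- The joint law of inputs and outputs together with all shared variables. -/
def full (c : Letter X Y B U) (PW : W → ℝ) (μ : X → ℝ) (z : (X × Y) × (U × (W × B))) : ℝ :=
  PW z.2.2.1 * c.joint μ (z.1, (z.2.1, z.2.2.2))

variable {PW : W → ℝ} {μ : X → ℝ}

theorem sum_full_mul (c : Letter X Y B U) (φ : (X × Y) × (U × (W × B)) → ℝ) :
    ∑ z, c.full PW μ z * φ z =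
      ∑ w, PW w * ∑ z : (X × Y) × (U × B), c.joint μ z * φ (z.1, (z.2.1, (w, z.2.2))) := by
  simp only [Fintype.sum_prod_type, full, Finset.mul_sum]
  have h : ∀ x y, ∑ u, ∑ w, ∑ b, PW w * c.joint μ ((x, y), (u, b)) * φ ((x, y), (u, (w, b))) =
      ∑ w, ∑ u, ∑ b, PW w * (c.joint μ ((x, y), (u, b)) * φ ((x, y), (u, (w, b)))) := by
    intro x y
    rw [Finset.sum_comm]
    simp only [mul_assoc]
  simp only [h]
  rw [Finset.sum_congr rfl fun x _ => Finset.sum_comm, Finset.sum_comm]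

theorem isDist_full (c : Letter X Y B U) (hPW : IsDist PW) (hμ : IsDist μ) :
    IsDist (c.full PW μ) := by
  refine ⟨fun z => mul_nonneg (hPW.1 _) (c.joint_nonneg hμ.1 _), ?_⟩
  have h := c.sum_full_mul (PW := PW) (μ := μ) fun _ => 1
  simpa [c.sum_joint hμ, hPW.2] using h

theorem sum_full (c : Letter X Y B U) (hPW : IsDist PW) (s : X × Y) :
    ∑ a, c.full PW μ (s, a) = c.out μ s := by
  simp only [full, out, Fintype.sum_prod_type]
  refine Finset.sum_congr rfl fun u _ => ?_
  rw [Finset.sum_comm]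
  simp only [← Finset.sum_mul, hPW.2, one_mul]

/-- The shared randomness left after one letter is `H(U) + gain + H(W)`. -/
theorem sum_full_condSurprisal (c : Letter X Y B U) (hPW : IsDist PW) (hμ : IsDist μ) :
    ∑ z, c.full PW μ z * condSurprisal (c.full PW μ) z = ent c.PU + c.gain μ + ent PW := by
  have hlog : ∀ w, PW w * ∑ z : (X × Y) × (U × B), c.joint μ z *
      condSurprisal (c.full PW μ) (z.1, (z.2.1, (w, z.2.2))) =
      PW w * ∑ z : (X × Y) × (U × B), (c.joint μ z * (Real.log (c.out μ z.1) +
        Real.log (c.PU z.2.1) - Real.log (c.joint μ z)) -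
        c.joint μ z * Real.log (c.PU z.2.1) - c.joint μ z * Real.log (PW w)) := by
    intro w
    by_cases hw : PW w = 0
    · simp [hw]
    congr 1
    refine Finset.sum_congr rfl fun z _ => ?_
    by_cases hz : c.joint μ z = 0
    · simp [hz]
    rw [condSurprisal, c.sum_full hPW, full, Real.log_mul hw hz]
    ring
  have hU : ∑ z : (X × Y) × (U × B), c.joint μ z * Real.log (c.PU z.2.1) = -ent c.PU := by
    have h : ∀ u, ∑ s : X × Y, ∑ b, c.joint μ (s, (u, b)) * Real.log (c.PU u) =
        c.PU u * Real.log (c.PU u) := by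
      intro u
      simp only [← Finset.sum_mul]
      congr 1
      rw [← mul_one (c.PU u), ← c.sum_kernels hμ u, Finset.mul_sum]
      refine Finset.sum_congr rfl fun s _ => ?_
      rw [Finset.mul_sum]
      exact Finset.sum_congr rfl fun b _ => by rw [joint]; ring
    rw [Fintype.sum_prod_type]
    simp only [Fintype.sum_prod_type (α₁ := U)]
    rw [Finset.sum_comm]
    simp only [h, ent, Real.negMulLog, neg_mul, Finset.sum_neg_distrib, neg_neg]
  have hg : ∑ z : (X × Y) × (U × B), c.joint μ z * (Real.log (c.out μ z.1) +
      Real.log (c.PU z.2.1) - Real.log (c.joint μ z)) = c.gain μ := rfl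
  rw [sum_full_mul]
  simp only [hlog, Finset.sum_sub_distrib, hg, hU, ← Finset.sum_mul, c.sum_joint hμ, one_mul]
  simp only [mul_sub, Finset.sum_sub_distrib, ← Finset.sum_mul, hPW.2, one_mul, ent,
    Real.negMulLog, neg_mul, Finset.sum_neg_distrib]
  ring

end Letter

/-! ### Continuity of relative entropy -/

section Continuity

theorem mul_log_sub_mul_log_le {p m : ℝ} (hp0 : 0 ≤ p) (hp1 : p ≤ 1) (hm0 : 0 ≤ m)
    (hm1 : m ≤ 1) :
    p * Real.log p - m * Real.log m ≤ |p - m| + Real.negMulLog |p - m| := by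
  have hd1 : |p - m| ≤ 1 := abs_le.2 ⟨by linarith, by linarith⟩
  have hd := Real.negMulLog_nonneg (abs_nonneg (p - m)) hd1
  rcases le_or_gt m p with h | h
  · rw [abs_of_nonneg (sub_nonneg.2 h)] at hd ⊢
    rcases hm0.eq_or_lt with h0 | h0
    · subst h0
      have : p * Real.log p ≤ 0 := mul_nonpos_of_nonneg_of_nonpos hp0 (Real.log_nonpos hp0 hp1)
      simp only [sub_zero, zero_mul] at hd ⊢
      linarith
    · have hp : 0 < p := h0.trans_le h
      have h1 : m * (Real.log p - Real.log m) ≤ p - m := by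
        rw [← Real.log_div hp.ne' h0.ne']
        have := mul_le_mul_of_nonneg_left (Real.log_le_sub_one_of_pos (div_pos hp h0)) hm0
        rw [mul_sub, mul_div_cancel₀ _ h0.ne', mul_one] at this
        exact this
      have h2 : (p - m) * Real.log p ≤ 0 :=
        mul_nonpos_of_nonneg_of_nonpos (sub_nonneg.2 h) (Real.log_nonpos hp0 hp1)
      nlinarith
  · have hpos : 0 < m - p := sub_pos.2 h
    rw [abs_sub_comm, abs_of_pos hpos, Real.negMulLog]
    have h1 : (m - p) * Real.log (m - p) ≤ (m - p) * Real.log m :=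
      mul_le_mul_of_nonneg_left (Real.log_le_log hpos (by linarith)) hpos.le
    have h2 : p * Real.log p ≤ p * Real.log m := by
      rcases hp0.eq_or_lt with h0 | h0
      · simp [← h0]
      · exact mul_le_mul_of_nonneg_left (Real.log_le_log h0 h.le) hp0
    nlinarith

variable {α : Type} [Fintype α]

theorem sum_negMulLog_le [Nonempty α] {d : α → ℝ} (hd : ∀ a, 0 ≤ d a) :
    ∑ a, Real.negMulLog (d a) ≤ (∑ a, d a) * Real.log (Fintype.card α) + 1 := by
  obtain ⟨k, hk⟩ : ∃ k : ℝ, k = Fintype.card α := ⟨_, rfl⟩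
  have hkpos : 0 < k := by rw [hk]; exact Nat.cast_pos.2 Fintype.card_pos
  rw [← hk]
  have h : ∀ a, Real.negMulLog (d a) ≤ d a * Real.log k + k⁻¹ := by
    intro a
    rcases (hd a).eq_or_lt with h0 | h0
    · rw [← h0]; simp [hkpos.le]
    have h1 := mul_le_mul_of_nonneg_left
      (Real.log_le_sub_one_of_pos (inv_pos.2 (mul_pos h0 hkpos))) h0.le
    rw [Real.log_inv, Real.log_mul h0.ne' hkpos.ne', mul_inv, mul_sub, ← mul_assoc,
      mul_inv_cancel₀ h0.ne', one_mul, mul_one] at h1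
    rw [Real.negMulLog]
    linarith
  refine (Finset.sum_le_sum fun a _ => h a).trans ?_
  rw [Finset.sum_add_distrib, ← Finset.sum_mul]
  simp only [Finset.sum_const, Finset.card_univ, nsmul_eq_mul, ← hk]
  rw [mul_inv_cancel₀ hkpos.ne']

theorem IsDist.le_one {p : α → ℝ} (hp : IsDist p) (a : α) : p a ≤ 1 :=
  hp.2 ▸ Finset.single_le_sum (fun a _ => hp.1 a) (Finset.mem_univ a)

theorem IsDist.nonempty {p : α → ℝ} (hp : IsDist p) : Nonempty α := by
  by_contra h
  rw [not_nonempty_iff] at h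
  simpa using hp.2

theorem relEnt_le_of_close {p m r : α → ℝ} (hp : IsDist p) (hm : IsDist m)
    (hpr : ∀ a, r a = 0 → p a = 0) (hmr : ∀ a, r a = 0 → m a = 0) {L δ : ℝ} (hL : 0 ≤ L)
    (hr : ∀ a, r a ≠ 0 → |Real.log (r a)| ≤ L) (hδ : ∑ a, |p a - m a| ≤ δ) :
    relEnt p r ≤ relEnt m r + δ * (1 + Real.log (Fintype.card α) + L) + 1 := by
  have := hp.nonempty
  have hlogc : 0 ≤ Real.log (Fintype.card α) :=
    Real.log_nonneg (by exact_mod_cast Fintype.card_pos)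
  have h : ∀ a, p a * Real.log (p a / r a) ≤ m a * Real.log (m a / r a) +
      (|p a - m a| + Real.negMulLog |p a - m a| + |p a - m a| * L) := by
    intro a
    by_cases h0 : r a = 0
    · simp [hpr a h0, hmr a h0]
    have hsplit : ∀ x : ℝ, x * Real.log (x / r a) = x * Real.log x - x * Real.log (r a) := by
      intro x
      by_cases hx : x = 0
      · simp [hx]
      rw [Real.log_div hx h0, mul_sub]
    rw [hsplit, hsplit]
    have h1 := mul_log_sub_mul_log_le (hp.1 a) (hp.le_one a) (hm.1 a) (hm.le_one a)
    have h2 : (m a - p a) * Real.log (r a) ≤ |p a - m a| * L := by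
      refine (le_abs_self _).trans ?_
      rw [abs_mul, abs_sub_comm]
      exact mul_le_mul_of_nonneg_left (hr a h0) (abs_nonneg _)
    linarith
  refine (Finset.sum_le_sum fun a _ => h a).trans ?_
  simp only [Finset.sum_add_distrib, ← Finset.sum_mul]
  have h1 := sum_negMulLog_le (d := fun a => |p a - m a|) fun a => abs_nonneg _
  have h2 := mul_le_mul_of_nonneg_right hδ hlogc
  have h3 := mul_le_mul_of_nonneg_right hδ hL
  rw [relEnt]
  linarith

end Continuity

/-! ### Concatenating blocks -/

section Blocks

variable {W X Y B U : Type} [Fintype W] [Fintype X] [Fintype Y] [Fintype B] [Fintype U]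
  {PW : W → ℝ} {μ : X → ℝ} {π : X × Y → ℝ} {n m N N' : ℕ}

theorem sum_pair_seq {α β : Type} [Fintype α] [Fintype β] (F : (Fin N → α × β) → ℝ) :
    ∑ g, F g = ∑ p : (Fin N → α) × (Fin N → β), F fun i => (p.1 i, p.2 i) :=
  Equiv.sum_comp (Equiv.arrowProdEquivProdArrow (Fin N) (fun _ => α) fun _ => β)
    fun z => F fun i => (z.1 i, z.2 i)

/-- The product of the output laws of a sequence of single-letter schemes. -/
def outLaw (c : Fin N → Letter X Y B U) (μ : X → ℝ) (p : (Fin N → X) × (Fin N → Y)) : ℝ :=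
  ∏ i, (c i).out μ (p.1 i, p.2 i)

theorem isDist_outLaw (c : Fin N → Letter X Y B U) (hμ : IsDist μ) : IsDist (outLaw c μ) := by
  refine ⟨fun p => Finset.prod_nonneg fun i _ => (c i).out_nonneg hμ.1 _, ?_⟩
  simp only [outLaw]
  rw [← sum_pair_seq fun g => ∏ i, (c i).out μ (g i)]
  exact sum_pi_prod_eq_one fun i => (c i).sum_out hμ

theorem outLaw_eq_zero {c : Fin N → Letter X Y B U}
    (hc : ∀ i s, π s = 0 → (c i).out μ s = 0) (p : (Fin N → X) × (Fin N → Y))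
    (hp : SeqCode.prodLaw π N p = 0) : outLaw c μ p = 0 := by
  obtain ⟨i, _, hi⟩ := Finset.prod_eq_zero_iff.1 hp
  exact Finset.prod_eq_zero (Finset.mem_univ i) (hc i _ hi)

theorem relEnt_outLaw {c : Fin N → Letter X Y B U} (hμ : IsDist μ)
    (hc : ∀ i s, π s = 0 → (c i).out μ s = 0) :
    relEnt (outLaw c μ) (SeqCode.prodLaw π N) = ∑ i, relEnt ((c i).out μ) π := by
  simp only [relEnt, outLaw, SeqCode.prodLaw]
  rw [← sum_pair_seq fun g => (∏ i, (c i).out μ (g i)) *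
    Real.log ((∏ i, (c i).out μ (g i)) / ∏ i, π (g i))]
  have h : ∀ g : Fin N → X × Y, (∏ i, (c i).out μ (g i)) *
      Real.log ((∏ i, (c i).out μ (g i)) / ∏ i, π (g i)) =
      ∑ i, (∏ i, (c i).out μ (g i)) * Real.log ((c i).out μ (g i) / π (g i)) := by
    intro g
    rw [← Finset.mul_sum]
    by_cases h0 : ∏ i, (c i).out μ (g i) = 0
    · simp [h0]
    have h1 : ∀ i, (c i).out μ (g i) ≠ 0 := fun i hi =>
      h0 (Finset.prod_eq_zero (Finset.mem_univ i) hi)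
    rw [← Finset.prod_div_distrib,
      Real.log_prod fun i _ => div_ne_zero (h1 i) fun hi => h1 i (hc i _ hi)]
  simp only [h]
  rw [Finset.sum_comm]
  refine Finset.sum_congr rfl fun i _ => ?_
  exact sum_pi_prod_mul_apply (fun i => (c i).sum_out hμ) i
    fun s => Real.log ((c i).out μ s / π s)

/-- The law of the auxiliary sequence. -/
def auxLaw (c : Fin N → Letter X Y B U) (t : Fin N → U) : ℝ := ∏ i, (c i).PU (t i)

theorem sum_auxLaw (c : Fin N → Letter X Y B U) : ∑ t, auxLaw c t = 1 :=
  sum_pi_prod_eq_one fun i => (c i).isDist_PU.2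

/-- The shared randomness produced by one block suffices to draw the auxiliary sequence of the
next block almost independently of the inputs and outputs. -/
theorem exists_block_state (c : Fin N → Letter X Y B U) (c' : Fin N' → Letter X Y B U)
    (hPW : IsDist PW) (hμ : IsDist μ) {v w ε : ℝ}
    (hv : ∀ i, ∑ z, (c i).full PW μ z * condSurprisal ((c i).full PW μ) z ^ 2 ≤ v)
    (hw : ∀ j, ∑ u, (c' j).PU u * Real.log ((c' j).PU u) ^ 2 ≤ w) (hε : 0 < ε)
    (hgap : (∑ j, ent (c' j).PU) + 3 * ε ≤
      ∑ i, (ent (c i).PU + (c i).gain μ + ent PW)) :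
    ∃ τ : (Fin N → U) → (Fin N → W) × (Fin N → B) → Fin N' → U, ∑ p, ∑ t',
      |(∑ t, auxLaw c t * (SeqCode.memoryless c t).stateLaw PW μ (τ t) p t') -
        outLaw c μ p * auxLaw c' t'| ≤
      Real.exp (-ε / 2) + 2 * (N * v / ε ^ 2) + 2 * (N' * w / ε ^ 2) := by
  obtain ⟨f, hf⟩ := exists_map_product_covering (fun i => (c i).isDist_full hPW hμ)
    (fun j => (c' j).isDist_PU) hv hw hε
    (by simpa only [fun i => (c i).sum_full_condSurprisal hPW hμ] using hgap)
  refine ⟨fun t h => f fun i => (t i, (h.1 i, h.2 i)), ?_⟩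
  simp only [Fintype.card_fin] at hf
  refine le_trans (le_of_eq ?_) hf
  rw [sum_pair_seq]
  refine Finset.sum_congr rfl fun p _ => Finset.sum_congr rfl fun t' _ => ?_
  congr 2
  · conv_rhs => rw [marg, sum_pair_seq, Fintype.sum_prod_type]
    refine Finset.sum_congr rfl fun t _ => ?_
    rw [sum_pair_seq, SeqCode.stateLaw, Finset.mul_sum]
    refine Finset.sum_congr rfl fun h _ => ?_
    rw [mul_ite, mul_zero]
    congr 1
    rw [SeqCode.law_memoryless, auxLaw, ← Finset.prod_mul_distrib]
    refine Finset.prod_congr rfl fun i _ => ?_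
    simp only [Letter.full, Letter.joint]
    ring
  · simp only [Letter.sum_full _ hPW, outLaw, auxLaw]

end Blocks

/-! ### Running many blocks -/

section Reachable

variable {W X Y B U : Type} [Fintype W] [Fintype X] [Fintype Y] [Fintype B] [Fintype U]
  {PW : W → ℝ} {μ : X → ℝ} {π : X × Y → ℝ} {n N N' : ℕ}

/-- Whatever the auxiliary letter, no pair forbidden by `π` is produced. -/
def Letter.IsSafe (c : Letter X Y B U) (μ : X → ℝ) (π : X × Y → ℝ) : Prop :=
  ∀ s, π s = 0 → ∀ u b, μ s.1 * c.PB s.1 u b * c.PY b u s.2 = 0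

theorem Letter.IsSafe.out_eq_zero {c : Letter X Y B U} (hc : c.IsSafe μ π) (s : X × Y)
    (hs : π s = 0) : c.out μ s = 0 := by
  refine Finset.sum_eq_zero fun h _ => ?_
  rw [Letter.joint, mul_right_comm (μ _), mul_right_comm, hc s hs, zero_mul]

theorem SeqCode.isSafe_memoryless {c : Fin N → Letter X Y B U} (hc : ∀ i, (c i).IsSafe μ π)
    (u : Fin N → U) : (SeqCode.memoryless c u : SeqCode W X Y B N).IsSafe PW μ π := by
  intro p hp h
  obtain ⟨i, _, hi⟩ := Finset.prod_eq_zero_iff.1 hp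
  rw [SeqCode.law_memoryless]
  refine Finset.prod_eq_zero (Finset.mem_univ i) ?_
  rw [hc i (p.1 i, p.2 i) hi, mul_zero]

/-- Some code of blocklength `n` simulates a law at relative entropy `F` from the target, and
leaves the parties with a shared sequence distributed like the auxiliary sequence of `c`,
up to total variation `δ`. -/
def IsReachable (PW : W → ℝ) (μ : X → ℝ) (π : X × Y → ℝ) (c : Fin N → Letter X Y B U) (n : ℕ)
    (δ F : ℝ) : Prop :=
  ∃ (C : SeqCode W X Y B n) (σ : (Fin n → W) × (Fin n → B) → Fin N → U)
    (M : (Fin n → X) × (Fin n → Y) → ℝ), C.IsSafe PW μ π ∧ IsDist M ∧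
    (∀ p, SeqCode.prodLaw π n p = 0 → M p = 0) ∧ relEnt M (SeqCode.prodLaw π n) = F ∧
    ∑ p, ∑ t, |C.stateLaw PW μ σ p t - M p * auxLaw c t| ≤ δ

theorem IsReachable.mono {c : Fin N → Letter X Y B U} {δ δ' F : ℝ}
    (h : IsReachable PW μ π c n δ F) (hδ : δ ≤ δ') : IsReachable PW μ π c n δ' F := by
  obtain ⟨C, σ, M, hC, hM, hac, hF, h⟩ := h
  exact ⟨C, σ, M, hC, hM, hac, hF, h.trans hδ⟩

theorem isReachable_zero {c : Fin N → Letter X Y B U} {u₀ : U}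
    (hc : ∀ i u, (c i).PU u = if u = u₀ then 1 else 0) : IsReachable PW μ π c 0 0 0 := by
  have haux : ∀ t, auxLaw c t = if (fun _ => u₀) = t then 1 else 0 := by
    intro t
    simp only [auxLaw, hc]
    split_ifs with h
    · subst h; simp
    · obtain ⟨i, hi⟩ := Function.ne_iff.1 h
      exact Finset.prod_eq_zero (Finset.mem_univ i) (if_neg (Ne.symm hi))
  refine ⟨SeqCode.memoryless (U := U) (fun i => i.elim0) fun i => i.elim0, fun _ _ => u₀,
    fun _ => 1, SeqCode.isSafe_memoryless (fun i => i.elim0) _, ⟨fun _ => zero_le_one, by simp⟩,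
    fun p hp => by simp [SeqCode.prodLaw] at hp, by simp [relEnt, SeqCode.prodLaw], ?_⟩
  refine le_of_eq (Finset.sum_eq_zero fun p _ => Finset.sum_eq_zero fun t _ => ?_)
  rw [haux, SeqCode.stateLaw]
  simp [SeqCode.law_memoryless]

theorem IsReachable.step {c : Fin N → Letter X Y B U} {c' : Fin N' → Letter X Y B U}
    {δ F : ℝ} (h : IsReachable PW μ π c n δ F) (hPW : IsDist PW) (hμ : IsDist μ)
    (d : (W × X) × (B × Y)) (hc : ∀ i, (c i).IsSafe μ π) {v ε : ℝ}
    (hv : ∀ i, ∑ z, (c i).full PW μ z * condSurprisal ((c i).full PW μ) z ^ 2 ≤ v)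
    (hv' : ∀ j, ∑ u, (c' j).PU u * Real.log ((c' j).PU u) ^ 2 ≤ v) (hε : 0 < ε)
    (hgap : (∑ j, ent (c' j).PU) + 3 * ε ≤
      ∑ i, (ent (c i).PU + (c i).gain μ + ent PW)) :
    IsReachable PW μ π c' (n + N)
      (δ + (Real.exp (-ε / 2) + 2 * (N * v / ε ^ 2) + 2 * (N' * v / ε ^ 2)))
      (F + ∑ i, relEnt ((c i).out μ) π) := by
  obtain ⟨C, σ, M, hC, hM, hac, hF, hδ⟩ := h
  obtain ⟨τ, hτ⟩ := exists_block_state c c' hPW hμ hv hv' hε hgap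
  have hsum := C.sum_abs_stateLaw_bind_le hPW hμ d σ (SeqCode.memoryless c) τ hM hδ hτ
  have hac' := outLaw_eq_zero fun i => (hc i).out_eq_zero
  have hP : ∀ p p', (fun f => M (pairAppend.symm f).1 * outLaw c μ (pairAppend.symm f).2)
      (pairAppend (p, p')) = M p * outLaw c μ p' := fun p p' => by
    simp only [Equiv.symm_apply_apply]
  have hO := isDist_outLaw c hμ
  refine ⟨C.bind σ (SeqCode.memoryless c),
    fun h => τ (σ (pairAppend.symm h).1) (pairAppend.symm h).2,
    fun f => M (pairAppend.symm f).1 * outLaw c μ (pairAppend.symm f).2,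
    hC.bind σ fun t => SeqCode.isSafe_memoryless hc t,
    ⟨fun f => mul_nonneg (hM.1 _) (hO.1 _), ?_⟩, ?_, ?_, ?_⟩
  · rw [sum_pairAppend]
    simp only [hP, ← Finset.mul_sum, hO.2, hM.2, mul_one]
  · intro p hp
    obtain ⟨⟨p, p'⟩, rfl⟩ := pairAppend.surjective p
    rw [SeqCode.prodLaw_pairAppend] at hp
    rw [hP]
    rcases mul_eq_zero.1 hp with hp | hp
    · rw [hac p hp, zero_mul]
    · rw [hac' p' hp, mul_zero]
  · rw [SeqCode.relEnt_pairAppend hP hM.2 hO.2 hac hac', hF,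
      relEnt_outLaw hμ fun i => (hc i).out_eq_zero]
  · rw [sum_pairAppend]
    simpa only [Equiv.symm_apply_apply] using hsum

theorem IsReachable.iterate {c : Fin N → Letter X Y B U}
    {δ F : ℝ} (h : IsReachable PW μ π c n δ F) (hPW : IsDist PW) (hμ : IsDist μ)
    (d : (W × X) × (B × Y)) (hc : ∀ i, (c i).IsSafe μ π) {v ε : ℝ}
    (hv : ∀ i, ∑ z, (c i).full PW μ z * condSurprisal ((c i).full PW μ) z ^ 2 ≤ v)
    (hv' : ∀ j, ∑ u, (c j).PU u * Real.log ((c j).PU u) ^ 2 ≤ v) (hε : 0 < ε)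
    (hgap : 3 * ε ≤ ∑ i, ((c i).gain μ + ent PW)) (K : ℕ) :
    IsReachable PW μ π c (n + K * N)
      (δ + K * (Real.exp (-ε / 2) + 4 * (N * v / ε ^ 2)))
      (F + K * ∑ i, relEnt ((c i).out μ) π) := by
  induction K with
  | zero => simpa using h
  | succ K ih =>
    have h1 := ih.step hPW hμ d hc hv hv' hε (by
      simp only [add_assoc]
      rw [Finset.sum_add_distrib]
      linarith)
    rw [Nat.succ_mul, ← add_assoc]
    convert h1 using 1 <;> push_cast <;> ring

theorem abs_log_prodLaw_le {L : ℝ} (hL : ∀ s, |Real.log (π s)| ≤ L)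
    (p : (Fin n → X) × (Fin n → Y)) (hp : SeqCode.prodLaw π n p ≠ 0) :
    |Real.log (SeqCode.prodLaw π n p)| ≤ n * L := by
  rw [SeqCode.prodLaw, Real.log_prod fun i _ hi => hp (Finset.prod_eq_zero (Finset.mem_univ i) hi)]
  calc _ ≤ ∑ i, |Real.log (π (p.1 i, p.2 i))| := Finset.abs_sum_le_sum_abs _ _
    _ ≤ ∑ _i : Fin n, L := Finset.sum_le_sum fun i _ => hL _
    _ = n * L := by simp

theorem IsReachable.GammaN_le {c : Fin N → Letter X Y B U} {δ F : ℝ}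
    (h : IsReachable PW (marg Prod.fst π) π c n δ F) (hPW : IsDist PW) (hπ : IsDist π)
    (d : (W × X) × (B × Y)) {L : ℝ} (hL : ∀ s, |Real.log (π s)| ≤ L) :
    GammaN W X Y B PW π n ≤ ENNReal.ofReal
      (F + δ * (1 + n * (Real.log (Fintype.card X * Fintype.card Y) + L)) + 1) := by
  obtain ⟨C, σ, M, hC, hM, hac, hF, hδ⟩ := h
  have hμ : IsDist (marg Prod.fst π) := hπ.marg _
  have hL0 : 0 ≤ L := (abs_nonneg _).trans (hL (d.1.2, d.2.2))
  have hout : IsDist (C.out PW (marg Prod.fst π)) :=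
    ⟨fun p => C.out_nonneg hPW hμ p, C.sum_out hPW hμ d⟩
  have hclose : ∑ p, |C.out PW (marg Prod.fst π) p - M p| ≤ δ := by
    refine (Finset.sum_le_sum fun p _ => ?_).trans hδ
    have h : C.out PW (marg Prod.fst π) p - M p =
        ∑ t, (C.stateLaw PW (marg Prod.fst π) σ p t - M p * auxLaw c t) := by
      rw [Finset.sum_sub_distrib, C.sum_stateLaw σ, ← Finset.mul_sum, sum_auxLaw, mul_one]
    rw [h]
    exact Finset.abs_sum_le_sum_abs _ _
  refine (_root_.GammaN_le C hC.out_eq_zero).trans (ENNReal.ofReal_le_ofReal ?_)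
  refine (relEnt_le_of_close hout hM hC.out_eq_zero hac (by positivity)
    (abs_log_prodLaw_le hL) hclose).trans (le_of_eq ?_)
  rw [hF, Fintype.card_prod, Fintype.card_fun, Fintype.card_fun, Fintype.card_fin,
    ← mul_pow, Nat.cast_pow, Real.log_pow]
  push_cast
  ring

end Reachable

/-! ### Achievability -/

/-- A deterministic sequence whose empirical averages match a given distribution. -/
theorem exists_schedule {V : Type} [Fintype V] {q : V → ℝ} (hq : IsDist q) (N : ℕ) :
    ∃ s : Fin N → V, ∀ f : V → ℝ, ∀ A : ℝ, (∀ a, |f a| ≤ A) →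
      |∑ i, f (s i) - N * ∑ a, q a * f a| ≤ 2 * Fintype.card V * A := by
  obtain ⟨v₀⟩ := hq.nonempty
  have hfl : ∀ a, (⌊N * q a⌋₊ : ℝ) ≤ N * q a := fun a =>
    Nat.floor_le (mul_nonneg N.cast_nonneg (hq.1 a))
  have hle : ∑ a, ⌊N * q a⌋₊ ≤ N := by
    have : ∑ a, (⌊N * q a⌋₊ : ℝ) ≤ N :=
      (Finset.sum_le_sum fun a _ => hfl a).trans_eq (by rw [← Finset.mul_sum, hq.2, mul_one])
    exact_mod_cast this
  obtain ⟨e⟩ : Nonempty ((Σ a, Fin ⌊N * q a⌋₊) ↪ Fin N) :=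
    Function.Embedding.nonempty_of_card_le (by simpa using hle)
  set s : Fin N → V := fun i => if h : ∃ z, e z = i then h.choose.1 else v₀ with hs
  have hse : ∀ z, s (e z) = z.1 := by
    intro z
    have h : ∃ z', e z' = e z := ⟨z, rfl⟩
    simp only [hs, dif_pos h]
    rw [e.injective h.choose_spec]
  refine ⟨s, fun f A hA => ?_⟩
  have hsplit : ∑ i, f (s i) =
      ∑ a, (⌊N * q a⌋₊ : ℝ) * f a + (N - ∑ a, (⌊N * q a⌋₊ : ℝ)) * f v₀ := by
    have h1 : ∑ i, (f (s i) - f v₀) = ∑ z, (f (s (e z)) - f v₀) := by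
      refine (Finset.sum_of_injOn e (e.injective.injOn) (by simp) ?_ fun _ _ => rfl).symm
      intro i _ hi
      have h : ¬∃ z, e z = i := fun ⟨z, hz⟩ => hi ⟨z, by simp, hz⟩
      simp only [hs, dif_neg h, sub_self]
    simp only [hse, Finset.sum_sub_distrib, Fintype.sum_sigma] at h1
    simp only [Finset.sum_const, Finset.card_univ, Fintype.card_fin, nsmul_eq_mul,
      ← Finset.sum_mul] at h1
    linarith
  have hid : ∑ i, f (s i) - N * ∑ a, q a * f a =
      ∑ a, (N * q a - ⌊N * q a⌋₊) * (f v₀ - f a) := by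
    rw [hsplit]
    have h1 : ∑ a, (N * q a - ⌊N * q a⌋₊) * (f v₀ - f a) = ∑ a, (N * f v₀ * q a -
        ⌊N * q a⌋₊ * f v₀ - N * (q a * f a) + ⌊N * q a⌋₊ * f a) :=
      Finset.sum_congr rfl fun a _ => by ring
    rw [h1]
    simp only [Finset.sum_add_distrib, Finset.sum_sub_distrib, ← Finset.mul_sum, ← Finset.sum_mul,
      hq.2]
    ring
  rw [hid]
  calc _ ≤ ∑ a, |(N * q a - ⌊N * q a⌋₊) * (f v₀ - f a)| := Finset.abs_sum_le_sum_abs _ _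
    _ ≤ ∑ _a : V, 2 * A := by
      refine Finset.sum_le_sum fun a _ => ?_
      rw [abs_mul, abs_of_nonneg (sub_nonneg.2 (hfl a))]
      have h1 := Nat.lt_floor_add_one (N * q a)
      have h2 : |f v₀ - f a| ≤ 2 * A := (abs_sub _ _).trans (by linarith [hA v₀, hA a])
      nlinarith [abs_nonneg (f v₀ - f a)]
    _ = _ := by simp; ring

theorem exists_forall_le_real {α : Type} [Finite α] (f : α → ℝ) : ∃ A, 0 ≤ A ∧ ∀ a, f a ≤ A := by
  obtain ⟨A, hA⟩ := (Set.finite_range f).bddAbove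
  exact ⟨max A 0, le_max_right _ _, fun a => (hA ⟨a, rfl⟩).trans (le_max_left _ _)⟩

section Achievability

variable {W X Y B U V : Type} [Fintype W] [Fintype X] [Fintype Y] [Fintype B] [Fintype U]
  [Fintype V] {PW : W → ℝ} {π : X × Y → ℝ}

theorem exists_isReachable (hPW : IsDist PW) {μ : X → ℝ} (hμ : IsDist μ)
    (d : (W × X) × (B × Y)) (c : V → Letter X Y B U) (hc : ∀ a, (c a).IsSafe μ π)
    {q : V → ℝ} (hq : IsDist q) (b : Letter X Y B U) (hb : b.IsSafe μ π) {u₀ : U}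
    (hbU : ∀ u, b.PU u = if u = u₀ then 1 else 0) (hbg : 0 < b.gain μ + ent PW)
    {γ : ℝ} (hγ0 : 0 < γ) (hγ : ∑ a, q a * ((c a).gain μ + ent PW) = γ) :
    ∃ r : ℕ, ∃ v A N₀ : ℝ, 0 ≤ v ∧ ∀ K N : ℕ, N₀ ≤ N → 1 ≤ N → ∃ s : Fin N → V,
      IsReachable PW μ π (fun i => c (s i)) (r * N + K * N)
        ((r + 1 + 2 * K) * ((12 / γ + 72 * v / γ ^ 2) / N))
        (r * N * relEnt (b.out μ) π + K * ∑ i, relEnt ((c (s i)).out μ) π) ∧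
      ∑ i, relEnt ((c (s i)).out μ) π ≤ N * (∑ a, q a * relEnt ((c a).out μ) π) + A := by
  obtain ⟨H, hH0, hH⟩ := exists_forall_le_real fun a => ent (c a).PU
  obtain ⟨G, hG0, hG⟩ := exists_forall_le_real fun a => |(c a).gain μ + ent PW|
  obtain ⟨D, hD0, hD⟩ := exists_forall_le_real fun a => |relEnt ((c a).out μ) π|
  obtain ⟨v₁, hv₁0, hv₁⟩ := exists_forall_le_real fun a =>
    ∑ z, (c a).full PW μ z * condSurprisal ((c a).full PW μ) z ^ 2
  obtain ⟨v₂, hv₂0, hv₂⟩ := exists_forall_le_real fun a =>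
    ∑ u, (c a).PU u * Real.log ((c a).PU u) ^ 2
  obtain ⟨v₃, hv₃0, hv₃⟩ := exists_forall_le_real fun _ : Unit =>
    ∑ z, b.full PW μ z * condSurprisal (b.full PW μ) z ^ 2
  obtain ⟨r, hr⟩ := exists_nat_ge ((H + γ) / (b.gain μ + ent PW))
  rw [div_le_iff₀ hbg] at hr
  obtain ⟨v, hv⟩ : ∃ v, v = v₁ + v₂ + v₃ := ⟨_, rfl⟩
  have hv0 : 0 ≤ v := by rw [hv]; positivity
  refine ⟨r, v, 2 * Fintype.card V * D, 4 * Fintype.card V * G / γ, hv0, fun K N hN hN1 => ?_⟩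
  have hNpos : (0 : ℝ) < N := by exact_mod_cast hN1
  rw [div_le_iff₀ hγ0] at hN
  obtain ⟨s, hs⟩ := exists_schedule hq N
  have hsG := abs_le.1 (hs _ G hG)
  have hsD := abs_le.1 (hs _ D hD)
  rw [hγ] at hsG
  have hε : 0 < N * γ / 6 := by positivity
  have hbent : 0 ≤ ent b.PU := Finset.sum_nonneg fun u _ =>
    Real.negMulLog_nonneg (b.isDist_PU.1 u) (b.isDist_PU.le_one u)
  have h0 := isReachable_zero (PW := PW) (μ := μ) (π := π) (c := fun _ : Fin (r * N) => b)
    fun _ => hbU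
  have h1 := h0.step (c' := fun i => c (s i)) hPW hμ d (fun _ => hb) (v := v)
    (fun _ => (hv₃ ()).trans (by rw [hv]; linarith))
    (fun j => (hv₂ (s j)).trans (by rw [hv]; linarith)) hε (by
      have h2 : ∑ j, ent (c (s j)).PU ≤ N * H :=
        (Finset.sum_le_sum fun j _ => hH (s j)).trans_eq (by simp)
      have h3 := mul_le_mul_of_nonneg_left hr hNpos.le
      have h4 : (0 : ℝ) ≤ r * N * ent b.PU := by positivity
      have h5 := mul_pos hNpos hγ0
      simp only [Finset.sum_const, Finset.card_univ, Fintype.card_fin, nsmul_eq_mul, Nat.cast_mul]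
      nlinarith)
  have h2 := h1.iterate hPW hμ d (fun i => hc (s i)) (v := v)
    (fun i => (hv₁ (s i)).trans (by rw [hv]; linarith))
    (fun j => (hv₂ (s j)).trans (by rw [hv]; linarith)) hε (by linarith [hsG.1]) K
  refine ⟨s, ?_, by linarith [hsD.2]⟩
  rw [Nat.zero_add] at h2
  have hF : 0 + ∑ _i : Fin (r * N), relEnt (b.out μ) π = r * N * relEnt (b.out μ) π := by simp
  rw [hF] at h2
  refine h2.mono ?_
  have he : Real.exp (-(N * γ / 6) / 2) ≤ 12 / γ / N := by
    have h3 := Real.add_one_le_exp (N * γ / 12)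
    have h4 : -(N * γ / 6) / 2 = -(N * γ / 12) := by ring
    have h5 : 12 / γ / N = (N * γ / 12)⁻¹ := by rw [inv_div, div_div, mul_comm γ]
    rw [h4, Real.exp_neg, h5]
    exact inv_anti₀ (by positivity) ((lt_add_one _).le.trans h3)
  have ht : N * v / (N * γ / 6) ^ 2 = 36 * v / γ ^ 2 / N := by
    field_simp
    ring
  have ht' : ((r * N : ℕ) : ℝ) * v / (N * γ / 6) ^ 2 = r * (36 * v / γ ^ 2 / N) := by
    rw [← ht]; push_cast; ring
  have hZ : (12 / γ + 72 * v / γ ^ 2) / N = 12 / γ / N + 2 * (36 * v / γ ^ 2 / N) := by ring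
  rw [ht, ht', hZ]
  have he0 : 0 ≤ 12 / γ / N := by positivity
  have hr0 : (0 : ℝ) ≤ r * (12 / γ / N) := by positivity
  have hK0 : (0 : ℝ) ≤ K * (12 / γ / N) := by positivity
  have hK1 := mul_le_mul_of_nonneg_left he (Nat.cast_nonneg (α := ℝ) K)
  linarith

theorem exists_GammaN_le (hPW : IsDist PW) (hπ : IsDist π) (d : (W × X) × (B × Y))
    (c : V → Letter X Y B U) (hc : ∀ a, (c a).IsSafe (marg Prod.fst π) π)
    {q : V → ℝ} (hq : IsDist q) (b : Letter X Y B U) (hb : b.IsSafe (marg Prod.fst π) π) {u₀ : U}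
    (hbU : ∀ u, b.PU u = if u = u₀ then 1 else 0)
    (hbg : 0 < b.gain (marg Prod.fst π) + ent PW)
    (hγ : 0 < ∑ a, q a * ((c a).gain (marg Prod.fst π) + ent PW)) {ε : ℝ} (hε : 0 < ε) :
    ∃ n : ℕ, n ≠ 0 ∧ GammaN W X Y B PW π n ≤ ENNReal.ofReal
      (n * (∑ a, q a * relEnt ((c a).out (marg Prod.fst π)) π + ε)) := by
  obtain ⟨r, v, A, N₀, hv, h⟩ :=
    exists_isReachable hPW (hπ.marg Prod.fst) d c hc hq b hb hbU hbg hγ rfl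
  obtain ⟨L, hL0, hL⟩ := exists_forall_le_real fun s => |Real.log (π s)|
  generalize hγ' : ∑ a, q a * ((c a).gain (marg Prod.fst π) + ent PW) = γ at h hγ
  generalize hD : ∑ a, q a * relEnt ((c a).out (marg Prod.fst π)) π = D at h ⊢
  generalize hDb : relEnt (b.out (marg Prod.fst π)) π = Db at h
  obtain ⟨Z, hZ⟩ : ∃ Z, Z = 12 / γ + 72 * v / γ ^ 2 := ⟨_, rfl⟩
  obtain ⟨L', hL'⟩ : ∃ L', L' = Real.log (Fintype.card X * Fintype.card Y) + L := ⟨_, rfl⟩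
  have hZ0 : 0 ≤ Z := by rw [hZ]; positivity
  have hL'0 : 0 ≤ L' := by
    have h1 : 0 < Fintype.card X := Fintype.card_pos_iff.2 ⟨d.1.2⟩
    have h2 : 0 < Fintype.card Y := Fintype.card_pos_iff.2 ⟨d.2.2⟩
    have h3 : (1 : ℝ) ≤ Fintype.card X * Fintype.card Y := by
      exact_mod_cast Nat.succ_le_of_lt (Nat.mul_pos h1 h2)
    rw [hL']
    exact add_nonneg (Real.log_nonneg h3) hL0
  obtain ⟨K, hK⟩ := exists_nat_ge (max 1 (2 * (r * (Db - D)) / ε))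
  have hK1 : (1 : ℝ) ≤ K := (le_max_left _ _).trans hK
  have hK2 := (le_max_right _ _).trans hK
  rw [div_le_iff₀ hε] at hK2
  obtain ⟨Q, hQ⟩ : ∃ Q, Q = K * A + (r + 1 + 2 * K) * Z * (1 + (r + K) * L') + 1 := ⟨_, rfl⟩
  obtain ⟨N, hN⟩ := exists_nat_ge (max (max N₀ 1) (2 * Q / ε))
  have hN1 : (1 : ℝ) ≤ N := (le_max_right _ _).trans ((le_max_left _ _).trans hN)
  have hNQ := (le_max_right _ _).trans hN
  rw [div_le_iff₀ hε] at hNQ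
  have hN0 : (0 : ℝ) < N := by linarith
  obtain ⟨s, hs, hsum⟩ := h K N ((le_max_left _ _).trans ((le_max_left _ _).trans hN))
    (by exact_mod_cast hN1)
  refine ⟨r * N + K * N, ?_, (hs.GammaN_le hPW hπ d hL).trans (ENNReal.ofReal_le_ofReal ?_)⟩
  · have h1 : 0 < N := by exact_mod_cast hN0
    have h2 : 0 < K := by exact_mod_cast (lt_of_lt_of_le one_pos hK1)
    positivity
  rw [← hL', ← hZ]
  push_cast
  have h1 : (r + 1 + 2 * K) * (Z / N) * (1 + (r * N + K * N) * L') ≤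
      (r + 1 + 2 * K) * Z * (1 + (r + K) * L') := by
    have h2 : (r + 1 + 2 * K) * Z * (1 + (r + K) * L') -
        (r + 1 + 2 * K) * (Z / N) * (1 + (r * N + K * N) * L') =
        (r + 1 + 2 * K) * (Z / N) * (N - 1) := by
      field_simp
      ring
    have h3 : 0 ≤ (r + 1 + 2 * K) * (Z / N) * (N - 1) :=
      mul_nonneg (by positivity) (by linarith)
    linarith
  have h2 := mul_le_mul_of_nonneg_left hsum (Nat.cast_nonneg (α := ℝ) K)
  have h3 := mul_le_mul_of_nonneg_left hK2 hN0.le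
  have h4 : Q ≤ K * (N * ε / 2) := by
    nlinarith [mul_nonneg (sub_nonneg.2 hK1) (mul_pos hN0 hε).le]
  have h5 : 0 ≤ r * (N * ε) := by positivity
  nlinarith

end Achievability

namespace Letter

variable {X Y B U : Type} [Fintype X] [Fintype Y] [Fintype B] [Fintype U]
  {μ : X → ℝ} {π : X × Y → ℝ}

/-- The scheme that outputs the constant `y₀` and sends a uniform symbol. -/
def fallback [Nonempty B] (u₀ : U) (y₀ : Y) : Letter X Y B U where
  PU u := if u = u₀ then 1 else 0
  PB _ _ _ := (Fintype.card B : ℝ)⁻¹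
  PY _ _ y := if y = y₀ then 1 else 0
  isDist_PU := ⟨fun u => by beta_reduce; split_ifs <;> norm_num, by simp⟩
  isDist_PB _ _ := ⟨fun _ => by positivity, by simp⟩
  isDist_PY _ _ := ⟨fun y => by beta_reduce; split_ifs <;> norm_num, by simp⟩

theorem isSafe_fallback [Nonempty B] (u₀ : U) {y₀ : Y}
    (hy : ∀ x, μ x ≠ 0 → π (x, y₀) ≠ 0) : (fallback u₀ y₀ : Letter X Y B U).IsSafe μ π := by
  rintro ⟨x, y⟩ hs u b
  by_cases h : y = y₀
  · subst h
    have hx : μ x = 0 := by_contra fun hx => hy x hx hs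
    simp [hx]
  · simp [fallback, h]

theorem gain_fallback [Nonempty B] (hμ : IsDist μ) (u₀ : U) (y₀ : Y) :
    (fallback u₀ y₀ : Letter X Y B U).gain μ = Real.log (Fintype.card B) := by
  have hout : ∀ x, (fallback u₀ y₀ : Letter X Y B U).out μ (x, y₀) = μ x := by
    intro x
    have hB : (Fintype.card B : ℝ) ≠ 0 := by simp
    simp only [out, joint, fallback, Fintype.sum_prod_type_right]
    simp
    field_simp
  have h : ∀ z, (fallback u₀ y₀ : Letter X Y B U).joint μ z *
      (Real.log ((fallback u₀ y₀ : Letter X Y B U).out μ z.1) +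
        Real.log ((fallback u₀ y₀ : Letter X Y B U).PU z.2.1) -
        Real.log ((fallback u₀ y₀ : Letter X Y B U).joint μ z)) =
      (fallback u₀ y₀ : Letter X Y B U).joint μ z * Real.log (Fintype.card B) := by
    rintro ⟨⟨x, y⟩, u, b⟩
    by_cases hu : u = u₀
    swap
    · simp [joint, fallback, hu]
    by_cases hy : y = y₀
    swap
    · simp [joint, fallback, hy]
    by_cases hx : μ x = 0
    · simp [joint, hx]
    subst hu hy
    rw [hout]
    congr 1
    simp only [joint, fallback, if_true, mul_one, Real.log_one, add_zero]
    rw [Real.log_mul hx (by simp), Real.log_inv]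
    ring
  rw [gain]
  simp only [h, ← Finset.sum_mul, sum_joint _ hμ, one_mul]

/-- A scheme whose output avoids the forbidden pairs can be made safe for every auxiliary
letter. -/
theorem exists_isSafe (c : Letter X Y B U) (hμ : IsDist μ)
    (h : ∀ s, π s = 0 → c.out μ s = 0) :
    ∃ c' : Letter X Y B U, c'.IsSafe μ π ∧ c'.out μ = c.out μ ∧ c'.gain μ = c.gain μ := by
  obtain ⟨u₁, hu₁⟩ : ∃ u, c.PU u ≠ 0 := by
    by_contra! h0
    simpa [h0] using c.isDist_PU.2
  set φ : U → U := fun u => if c.PU u = 0 then u₁ else u with hφ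
  have hφ0 : ∀ u, c.PU (φ u) ≠ 0 := fun u => by
    simp only [hφ]; split_ifs with h1; exacts [hu₁, h1]
  let c' : Letter X Y B U :=
    { PU := c.PU
      PB := fun x u => c.PB x (φ u)
      PY := fun b u => c.PY b (φ u)
      isDist_PU := c.isDist_PU
      isDist_PB := fun x u => c.isDist_PB x _
      isDist_PY := fun b u => c.isDist_PY b _ }
  have hj : c'.joint μ = c.joint μ := by
    funext z
    by_cases hz : c.PU z.2.1 = 0
    · simp [joint, c', hz]
    · simp [joint, c', hφ, hz]
  have ho : c'.out μ = c.out μ := by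
    funext s
    simp only [out, hj]
  refine ⟨c', fun s hs u b => ?_, ho, ?_⟩
  · have h1 : c.joint μ (s, (φ u, b)) = 0 :=
      le_antisymm ((h s hs) ▸ c.joint_le_out hμ.1 (s, (φ u, b))) (c.joint_nonneg hμ.1 _)
    rw [joint, mul_right_comm (μ _), mul_right_comm, mul_eq_zero] at h1
    exact h1.resolve_right (hφ0 u)
  · simp only [gain, hj, ho]
    rfl

/-- Every joint law of the auxiliary variables is a mixture of single-letter schemes. -/
theorem exists_mix_eq {V : Type} [Fintype V] {PUV : U × V → ℝ} {PB : X × U × V → B → ℝ}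
    {PY : B × U × V → Y → ℝ} (hPUV : IsDist PUV) (hPB : IsKernel PB) (hPY : IsKernel PY) :
    ∃ c : V → Letter X Y B U, (fun p : U × V => marg Prod.snd PUV p.2 * (c p.2).PU p.1) = PUV ∧
      mix (marg Prod.snd PUV) c μ = seqJoint μ PUV PB PY := by
  obtain ⟨⟨u₀, -⟩⟩ := hPUV.nonempty
  have hq := hPUV.marg Prod.snd
  let c : V → Letter X Y B U := fun v =>
    { PU := fun u => if marg Prod.snd PUV v = 0 then (if u = u₀ then 1 else 0)
        else PUV (u, v) / marg Prod.snd PUV v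
      PB := fun x u => PB (x, u, v)
      PY := fun b u => PY (b, u, v)
      isDist_PU := by
        by_cases h : marg Prod.snd PUV v = 0
        · simp only [if_pos h]
          exact ⟨fun u => by beta_reduce; split_ifs <;> norm_num, by simp⟩
        · simp only [if_neg h]
          refine ⟨fun u => div_nonneg (hPUV.1 _) (hq.1 _), ?_⟩
          rw [← Finset.sum_div, ← marg_snd_apply, div_self h]
      isDist_PB := fun x u => hPB _
      isDist_PY := fun b u => hPY _ }
  have hc : (fun p : U × V => marg Prod.snd PUV p.2 * (c p.2).PU p.1) = PUV := by
    funext ⟨u, v⟩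
    by_cases h : marg Prod.snd PUV v = 0
    · have h1 := h
      rw [marg_snd_apply, Finset.sum_eq_zero_iff_of_nonneg fun _ _ => hPUV.1 _] at h1
      simp [h, h1 u]
    · simp only [c, if_neg h]
      rw [mul_div_cancel₀ _ h]
  refine ⟨c, hc, ?_⟩
  rw [mix, hc]

end Letter

section Limit

variable {W X Y B : Type} [Fintype W] [Fintype X] [Fintype Y] [Fintype B]
  {PW : W → ℝ} {π : X × Y → ℝ}

theorem exists_GammaN_le_of_mem_psiSetBdd (hPW : IsDist PW) (hπ : IsDist π)
    (d : (W × X) × (B × Y)) (hB : 2 ≤ Fintype.card B) {y₀ : Y}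
    (hy : ∀ x, marg Prod.fst π x ≠ 0 → π (x, y₀) ≠ 0) {D : ℝ≥0∞}
    (hD : D ∈ psiSetBdd X Y B π (ent PW)) (hD' : D ≠ ⊤) {ε : ℝ} (hε : 0 < ε) :
    ∃ n : ℕ, n ≠ 0 ∧ GammaN W X Y B PW π n ≤ n * (D + ENNReal.ofReal ε) := by
  obtain ⟨m, l, -, -, PUV, PB, PY, hPUV, hPB, hPY, hfeas, rfl⟩ := hD
  have hμ : IsDist (marg Prod.fst π) := hπ.marg _
  have : Nonempty B := ⟨d.2.1⟩
  obtain ⟨⟨u₀, -⟩⟩ := hPUV.nonempty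
  obtain ⟨c, hc, hmix⟩ := Letter.exists_mix_eq (μ := marg Prod.fst π) hPUV hPB hPY
  have hq : IsDist (marg Prod.snd PUV) := hPUV.marg _
  generalize hqq : marg Prod.snd PUV = q at hq hc hmix hD' ⊢
  have hgain := Letter.condEnt_mix_sub q c (marg Prod.fst π) hq.1 hμ
  rw [hmix] at hgain
  have hac : ∀ r : X × Fin l × Y, q r.2.1 * π (r.1, r.2.2) = 0 →
      marg (fun a : X × Fin m × Fin l × B × Y => (a.1, a.2.2.1, a.2.2.2.2))
        (seqJoint (marg Prod.fst π) PUV PB PY) r = 0 := by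
    by_contra hcon
    exact hD' (if_neg hcon)
  have hent := Letter.relEnt_mix q c (marg Prod.fst π) π
  rw [hc, hqq, hmix] at hent
  rw [KL_eq_ofReal_relEnt hac, hent]
  rw [← hmix] at hac
  have hex : ∀ v, ∃ c' : Letter X Y B (Fin m), c'.IsSafe (marg Prod.fst π) π ∧
      (q v ≠ 0 → c'.out (marg Prod.fst π) = (c v).out (marg Prod.fst π) ∧
        c'.gain (marg Prod.fst π) = (c v).gain (marg Prod.fst π)) := by
    intro v
    by_cases hv : q v = 0
    · exact ⟨Letter.fallback u₀ y₀, Letter.isSafe_fallback u₀ hy, fun h => absurd hv h⟩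
    obtain ⟨c', h1, h2⟩ := (c v).exists_isSafe (π := π) hμ fun s hs => by
      have h := hac (s.1, v, s.2) (by simp [hs])
      rw [Letter.marg_mix_XVY] at h
      exact (mul_eq_zero.1 h).resolve_left hv
    exact ⟨c', h1, fun _ => h2⟩
  choose c' hsafe hc' using hex
  have hgain' : ∀ v, q v * (c' v).gain (marg Prod.fst π) = q v * (c v).gain (marg Prod.fst π) :=
    fun v => by
      by_cases hv : q v = 0
      · simp [hv]
      · rw [(hc' v hv).2]
  have hent' : ∀ v, q v * relEnt ((c' v).out (marg Prod.fst π)) π =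
      q v * relEnt ((c v).out (marg Prod.fst π)) π := fun v => by
    by_cases hv : q v = 0
    · simp [hv]
    · rw [(hc' v hv).1]
  set b : Letter X Y B (Fin m) := Letter.fallback u₀ y₀ with hb
  have hbgain : 0 < b.gain (marg Prod.fst π) := by
    rw [hb, Letter.gain_fallback hμ]
    exact Real.log_pos (by exact_mod_cast hB)
  have hPWent : 0 ≤ ent PW :=
    Finset.sum_nonneg fun w _ => Real.negMulLog_nonneg (hPW.1 w) (hPW.le_one w)
  obtain ⟨D, hDD⟩ : ∃ D, D = ∑ v, q v * relEnt ((c v).out (marg Prod.fst π)) π := ⟨_, rfl⟩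
  obtain ⟨Db, hDb⟩ : ∃ Db, Db = relEnt (b.out (marg Prod.fst π)) π := ⟨_, rfl⟩
  obtain ⟨η, hη⟩ : ∃ η, η = min (1 / 2) (ε / (2 * (|Db - D| + 1))) := ⟨_, rfl⟩
  have hη0 : 0 < η := by rw [hη]; positivity
  have hη1 : η ≤ 1 / 2 := hη ▸ min_le_left _ _
  have hη2 : η * (Db - D) ≤ ε / 2 := by
    have h1 : η ≤ ε / (2 * (|Db - D| + 1)) := hη ▸ min_le_right _ _
    rw [le_div_iff₀ (by positivity)] at h1
    nlinarith [mul_le_mul_of_nonneg_left (le_abs_self (Db - D)) hη0.le]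
  obtain ⟨n, hn, h⟩ := exists_GammaN_le (V := Option (Fin l)) hPW hπ d
    (fun a => a.elim b c') (by
      rintro (_ | v)
      exacts [Letter.isSafe_fallback u₀ hy, hsafe v])
    (q := fun a => a.elim η fun v => (1 - η) * q v) (by
      refine ⟨?_, ?_⟩
      · rintro (_ | v)
        exacts [hη0.le, mul_nonneg (by linarith) (hq.1 v)]
      · simp [Fintype.sum_option, ← Finset.mul_sum, hq.2])
    b (Letter.isSafe_fallback u₀ hy) (u₀ := u₀) (fun _ => rfl) (by linarith) (by
      simp only [Fintype.sum_option, Option.elim, mul_assoc, ← Finset.mul_sum]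
      simp only [mul_add, Finset.sum_add_distrib, hgain', ← Finset.sum_mul, hq.2, ← hgain]
      nlinarith) (half_pos hε)
  refine ⟨n, hn, h.trans ?_⟩
  simp only [Fintype.sum_option, Option.elim, mul_assoc, ← Finset.mul_sum, hent', ← hDD, ← hDb]
  calc ENNReal.ofReal (n * (η * Db + (1 - η) * D + ε / 2))
      ≤ ENNReal.ofReal (n * (D + ε)) := 
        ENNReal.ofReal_le_ofReal (mul_le_mul_of_nonneg_left (by linarith) (Nat.cast_nonneg n))
    _ = n * ENNReal.ofReal (D + ε) := by
        rw [ENNReal.ofReal_mul (Nat.cast_nonneg n), ENNReal.ofReal_natCast]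
    _ ≤ n * (ENNReal.ofReal D + ENNReal.ofReal ε) := by gcongr; exact ENNReal.ofReal_add_le

end Limit

/-- under the stated assumptions,
`Γ(π_{XY}, P_W) = lim_n Γ^{(n)}/n` exists and equals `Δ(π_{XY}, P_W)`,
the minimum of `D(P_{Y|XV}‖π_{Y|X}|π_X P_V)` over auxiliary alphabets with
`|𝒱| ≤ 2`, `|𝒰| ≤ 2|𝒳||𝒴|` and distributions satisfying
`H(U|V) ≤ H(BU|XYV) + H(W)`. -/
theorem sequential_channel_synthesis
    (W X Y B : Type) [Fintype W] [Fintype X] [Fintype Y] [Fintype B]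
    (PW : W → ℝ) (hPW : IsDist PW)
    (π : X × Y → ℝ) (hπ : IsDist π)
    (hB : 2 ≤ Fintype.card B)
    (hy : ∃ y : Y, ∀ x : X, 0 < marg Prod.fst π x → 0 < π (x, y)) :
    Filter.Tendsto (fun n : ℕ => GammaN W X Y B PW π n / (n : ℝ≥0∞)) Filter.atTop
      (nhds (sInf (psiSetBdd X Y B π (ent PW)))) := by
  obtain ⟨y₀, hy₀⟩ := hy
  have hμ : IsDist (marg Prod.fst π) := hπ.marg _
  have hy : ∀ x, marg Prod.fst π x ≠ 0 → π (x, y₀) ≠ 0 := fun x hx =>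
    (hy₀ x ((hμ.1 x).lt_of_ne' hx)).ne'
  obtain ⟨w₀⟩ := hPW.nonempty
  obtain ⟨x₀, -⟩ := hπ.nonempty
  have : Nonempty B := Fintype.card_pos_iff.1 (by lia)
  let d : (W × X) × (B × Y) := ((w₀, x₀), (Classical.arbitrary B, y₀))
  have hfin : ∀ n, GammaN W X Y B PW π n ≠ ⊤ := fun n =>
    ((GammaN_le (SeqCode.memoryless (fun _ => Letter.fallback () y₀) fun _ => ())
      (SeqCode.isSafe_memoryless (fun _ => Letter.isSafe_fallback () hy) _).out_eq_zero).trans_lt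
      ENNReal.ofReal_lt_top).ne
  have hsub : Subadditive fun n => (GammaN W X Y B PW π n).toReal := fun m n => by
    rw [← ENNReal.toReal_add (hfin m) (hfin n)]
    exact ENNReal.toReal_mono (ENNReal.add_ne_top.2 ⟨hfin m, hfin n⟩)
      (GammaN_add_le hPW hπ d m n)
  have hbdd : BddBelow (Set.range fun n : ℕ => (GammaN W X Y B PW π n).toReal / n) :=
    ⟨0, by rintro _ ⟨n, rfl⟩; positivity⟩
  have hdiv : ∀ n : ℕ, n ≠ 0 → ENNReal.ofReal ((GammaN W X Y B PW π n).toReal / n) =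
      GammaN W X Y B PW π n / n := fun n hn => by
    rw [ENNReal.ofReal_div_of_pos (by positivity), ENNReal.ofReal_toReal (hfin n),
      ENNReal.ofReal_natCast]
  have htend : Filter.Tendsto (fun n : ℕ => GammaN W X Y B PW π n / (n : ℝ≥0∞)) Filter.atTop
      (nhds (ENNReal.ofReal hsub.lim)) :=
    ((ENNReal.tendsto_ofReal (hsub.tendsto_lim hbdd))).congr'
      ((Filter.eventually_ne_atTop 0).mono hdiv)
  refine (le_antisymm (le_sInf fun D hD => ?_) ?_ :
    ENNReal.ofReal hsub.lim = sInf (psiSetBdd X Y B π (ent PW))) ▸ htend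
  · by_cases hD' : D = ⊤
    · simp [hD']
    refine ENNReal.le_of_forall_pos_le_add fun ε hε _ => ?_
    obtain ⟨n, hn, h⟩ := exists_GammaN_le_of_mem_psiSetBdd hPW hπ d hB hy hD hD' (ε := ε) hε
    calc ENNReal.ofReal hsub.lim
        ≤ GammaN W X Y B PW π n / n :=
          hdiv n hn ▸ ENNReal.ofReal_le_ofReal (hsub.lim_le_div hbdd hn)
      _ ≤ D + ε := ENNReal.div_le_of_le_mul (by rwa [mul_comm, ← ENNReal.ofReal_coe_nnreal])
  · exact ge_of_tendsto htend ((Filter.eventually_ne_atTop 0).mono fun n hn =>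
      sInf_psiSetBdd_le_GammaN hPW hπ d hn)

end
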